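/- arXiv:2507.15525 — 3 statements merged into one kernel-verified Lean document; each statement's English description precedes it below -/
import Mathlib

section
/- Let k be a field of characteristic zero and i ≥ 2 an integer. Let d_i be a derivation of R_i = k[x₁,…,x_i] such that whenever d_i(r) ∈ k[x_i] with deg ≤ l for r ∈ R_i, then r ∈ k and d_i(r) = 0. Let g_i ∈ k[x_i] \ k with deg_{x_i} g_i ≤ l, and define the derivation d_{i+1} = d_i + g_i(x_i) ∂_{x_{i+1}} of R_{i+1} = R_i[x_{i+1}]. If f ∈ R_{i+1} satisfies d_{i+1}(f) = h(x_{i+1}) for some h ∈ k[x_{i+1}], then f ∈ k and h = 0. -/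
open MvPolynomial

/-- Let `δ` be a derivation such that `δ r = g(y)` with `deg g ≤ l` forces `r ∈ k` and `g = 0`. Then
the extension of `δ` to `A[X]` sending `X` to `gi(y)`, described here through coefficients, sends
only constants to polynomials with coefficients in `k`. -/
theorem Derivation.eq_const_of_coeff_eq {k A : Type*} [Field k] [CharZero k] [CommRing A]
    [Algebra k A] (l : ℕ∞) (δ : Derivation k A A) (y : A)
    (hδ : ∀ (r : A) (g : Polynomial k), (g.natDegree : ℕ∞) ≤ l → δ r = Polynomial.aeval y g →
      (∃ c : k, r = algebraMap k A c) ∧ g = 0)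
    (gi : Polynomial k) (hgnc : 0 < gi.natDegree) (hgdeg : (gi.natDegree : ℕ∞) ≤ l)
    (F : Polynomial A) (h : Polynomial k)
    (hcoeff : ∀ j, algebraMap k A (h.coeff j) =
      δ (F.coeff j) + Polynomial.aeval y gi * (F.coeff (j + 1) * (j + 1))) :
    (∃ c : k, F = Polynomial.C (algebraMap k A c)) ∧ h = 0 := by
  have htop (j : ℕ) (hj : F.natDegree ≤ j) :
      (∃ c : k, F.coeff j = algebraMap k A c) ∧ h.coeff j = 0 := by
    have hj' := (hcoeff j).symm
    rw [Polynomial.coeff_eq_zero_of_natDegree_lt (Nat.lt_succ_of_le hj)] at hj'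
    have := hδ (F.coeff j) (Polynomial.C (h.coeff j)) (by simp) (by simpa using hj')
    exact ⟨this.1, by simpa using this.2⟩
  obtain ⟨c, hc⟩ := (htop _ le_rfl).1
  rcases hn : F.natDegree with _ | m
  · rw [hn] at hc htop
    refine ⟨⟨c, ?_⟩, ?_⟩
    · rw [← hc]
      exact Polynomial.eq_C_of_natDegree_eq_zero hn
    · ext j
      simpa using (htop j (Nat.zero_le j)).2
  · exfalso
    rw [hn] at hc
    have hm := (hcoeff m).symm
    rw [hc] at hm
    have hc0 : c ≠ 0 := by
      rintro rfl
      rw [map_zero, ← hn, Polynomial.coeff_natDegree, Polynomial.leadingCoeff_eq_zero] at hc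
      simp [hc] at hn
    have hcm : c * ((m : k) + 1) ≠ 0 := mul_ne_zero hc0 (Nat.cast_add_one_ne_zero m)
    have hdeg : (Polynomial.C (h.coeff m) - gi * Polynomial.C (c * ((m : k) + 1))).natDegree =
        gi.natDegree := by
      rw [Polynomial.natDegree_sub, Polynomial.natDegree_sub_C, Polynomial.natDegree_mul_C hcm]
    have h0 := (hδ (F.coeff m) (Polynomial.C (h.coeff m) - gi * Polynomial.C (c * ((m : k) + 1)))
      (by rwa [hdeg]) (by
        rw [eq_sub_of_add_eq hm]
        simp)).2
    rw [h0, Polynomial.natDegree_zero] at hdeg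
    omega

namespace MvPolynomial

/-- View a polynomial in `n + 1` variables as a polynomial in the last variable. -/
noncomputable def toPolynomialLast (k : Type*) [CommRing k] (n : ℕ) :
    MvPolynomial (Fin (n + 1)) k →ₐ[k] Polynomial (MvPolynomial (Fin n) k) :=
  aeval (Fin.lastCases Polynomial.X fun j => Polynomial.C (X j))

section

variable {k : Type*} [CommRing k] {n : ℕ}

@[simp]
theorem toPolynomialLast_X_last : toPolynomialLast k n (X (Fin.last n)) = Polynomial.X := by
  simp [toPolynomialLast]

@[simp]
theorem toPolynomialLast_X_castSucc (j : Fin n) :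
    toPolynomialLast k n (X j.castSucc) = Polynomial.C (X j) := by
  simp [toPolynomialLast]

@[simp]
theorem toPolynomialLast_rename (p : MvPolynomial (Fin n) k) :
    toPolynomialLast k n (rename Fin.castSucc p) = Polynomial.C p := by
  induction p using MvPolynomial.induction_on with
  | C a => simp [toPolynomialLast, Polynomial.algebraMap_apply, algebraMap_eq]
  | add p q hp hq => simp [hp, hq]
  | mul_X p j hp => simp [hp]

theorem eval₂_toPolynomialLast (p : MvPolynomial (Fin (n + 1)) k) :
    (toPolynomialLast k n p).eval₂ (rename Fin.castSucc).toRingHom (X (Fin.last n)) = p := by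
  induction p using MvPolynomial.induction_on with
  | C a => simp [toPolynomialLast, Polynomial.algebraMap_apply, algebraMap_eq]
  | add p q hp hq => simp only [map_add, Polynomial.eval₂_add, hp, hq]
  | mul_X p j hp =>
    rw [map_mul, Polynomial.eval₂_mul, hp]
    induction j using Fin.lastCases <;> simp

theorem coeff_toPolynomialLast_derivation
    (δ : Derivation k (MvPolynomial (Fin n) k) (MvPolynomial (Fin n) k))
    (d : Derivation k (MvPolynomial (Fin (n + 1)) k) (MvPolynomial (Fin (n + 1)) k))
    (g : MvPolynomial (Fin n) k)
    (hres : ∀ j : Fin n, d (X j.castSucc) = rename Fin.castSucc (δ (X j)))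
    (hlast : d (X (Fin.last n)) = rename Fin.castSucc g) (p : MvPolynomial (Fin (n + 1)) k)
    (m : ℕ) :
    (toPolynomialLast k n (d p)).coeff m = δ ((toPolynomialLast k n p).coeff m) +
      g * ((toPolynomialLast k n p).coeff (m + 1) * (m + 1)) := by
  induction p using MvPolynomial.induction_on generalizing m with
  | C a =>
    rcases m with _ | m <;>
      simp [toPolynomialLast, Polynomial.algebraMap_apply, algebraMap_eq, Polynomial.coeff_C]
  | add p q hp hq =>
    simp only [map_add, Polynomial.coeff_add, hp, hq]
    ring
  | mul_X p j hp =>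
    induction j using Fin.lastCases with
    | last =>
      rcases m with _ | m
      · simp [hlast, mul_comm]
      · simp [hlast, hp]
        ring
    | cast j =>
      simp [hres, hp]
      ring

end

end MvPolynomial

/-- Let `d_i` be a derivation of `k[x₁,…,x_i]` (`i ≥ 2`) such that
`d_i r = g(x_i)` with `deg g ≤ l` forces `r ∈ k`, `g = 0`. If `g_i ∈ k[x_i] \ k` with
`deg g_i ≤ l` and `d = d_i + g_i(x_i) ∂_{x_{i+1}}` on `k[x₁,…,x_{i+1}]`, then
`d f = h(x_{i+1})` forces `f ∈ k` and `h = 0`. -/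
theorem stmt7 (k : Type*) [Field k] [CharZero k] (i : ℕ) (hi : 2 ≤ i) (l : ℕ∞)
    (di : Derivation k (MvPolynomial (Fin i) k) (MvPolynomial (Fin i) k))
    (hdi : ∀ (r : MvPolynomial (Fin i) k) (g : Polynomial k),
      (g.natDegree : ℕ∞) ≤ l →
      di r = Polynomial.aeval (X (⟨i - 1, by omega⟩ : Fin i)) g →
      (∃ c : k, r = C c) ∧ g = 0)
    (gi : Polynomial k) (hgnc : 0 < gi.natDegree) (hgdeg : (gi.natDegree : ℕ∞) ≤ l)
    (d : Derivation k (MvPolynomial (Fin (i + 1)) k) (MvPolynomial (Fin (i + 1)) k))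
    (hres : ∀ j : Fin i, d (X (Fin.castSucc j)) = rename Fin.castSucc (di (X j)))
    (hlast : d (X (Fin.last i)) =
      Polynomial.aeval (X (⟨i - 1, by omega⟩ : Fin (i + 1))) gi)
    (f : MvPolynomial (Fin (i + 1)) k) (h : Polynomial k)
    (hf : d f = Polynomial.aeval (X (Fin.last i)) h) :
    (∃ c : k, f = C c) ∧ h = 0 := by
  have hlast' : d (X (Fin.last i)) =
      rename Fin.castSucc (Polynomial.aeval (X (⟨i - 1, by omega⟩ : Fin i)) gi) := by
    rw [hlast, ← Polynomial.aeval_algHom_apply, rename_X]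
    rfl
  have hF := coeff_toPolynomialLast_derivation di d _ hres hlast' f
  rw [hf, ← Polynomial.aeval_algHom_apply, toPolynomialLast_X_last,
    Polynomial.aeval_X_left_eq_map] at hF
  obtain ⟨⟨c, hc⟩, h0⟩ := Derivation.eq_const_of_coeff_eq l di _ hdi gi hgnc hgdeg
    (toPolynomialLast k i f) h (fun j => by rw [← hF j, Polynomial.coeff_map])
  refine ⟨⟨c, ?_⟩, h0⟩
  rw [← eval₂_toPolynomialLast f, hc]
  simp [algebraMap_eq]
end

section
/- Let k be a field of characteristic zero, i ≥ 2, n > i, and let d_n = d_i + g_i(x_i)∂_{x_{i+1}} + … + g_{n-1}(x_{n-1})∂_{x_n} with g_j ∈ k[x_j] \ k and deg_{x_i} g_i ≤ l, where d_i is a derivation of R_i = k[x₁,…,x_i] satisfying: (i) d_i(r) = g(x_i) with deg_{x_i} g ≤ l implies r ∈ k and g = 0; (ii) some monomial-exponent matrix A_{d_i} associated to d_i satisfies that (A_{d_i} - I)Y ≤ 0 has no nontrivial nonnegative integer solution; (iii) the isotropy group Aut(R_i)_{d_i} is trivial. Then Aut(R_n)_{d_n} = { (x₁, …, x_{n-1},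 x_n + c) : c ∈ k }, the group of translations in the last variable. -/
open MvPolynomial

/-- A derivation is locally nilpotent if every element is killed by one of its iterates. -/
def LocNilp {k R : Type*} [CommRing k] [CommRing R] [Algebra k R] (δ : Derivation k R R) : Prop :=
  ∀ r, ∃ m : ℕ, δ^[m] r = 0

theorem iterate_eq_zero_of_le {k R : Type*} [CommRing k] [CommRing R] [Algebra k R]
    (δ : Derivation k R R) {r : R} {m n : ℕ} (h : δ^[m] r = 0) (hmn : m ≤ n) : δ^[n] r = 0 := by
  obtain ⟨s, rfl⟩ := Nat.exists_eq_add_of_le hmn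
  rw [Nat.add_comm, Function.iterate_add_apply, h]
  exact Function.iterate_fixed (map_zero δ) s

section Exponential

variable {k R : Type*} [Field k] [CommRing R] [Algebra k R]

theorem exists_expPoly {Δ : Derivation k R R} (hΔ : LocNilp Δ) (r : R) :
    ∃ p : Polynomial R, ∀ m, p.coeff m = (m.factorial : k)⁻¹ • Δ^[m] r := by
  obtain ⟨N, hN⟩ := hΔ r
  refine ⟨∑ m ∈ Finset.range N, Polynomial.monomial m ((m.factorial : k)⁻¹ • Δ^[m] r), fun m => ?_⟩
  rw [Polynomial.finsetSum_coeff]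
  simp only [Polynomial.coeff_monomial]
  rw [Finset.sum_ite_eq' (Finset.range N) m]
  split_ifs with h
  · rfl
  · rw [iterate_eq_zero_of_le Δ hN (by simpa using h), smul_zero]

/-- The polynomial `∑ Δ^m(r) t^m / m!`. -/
noncomputable def expPoly {Δ : Derivation k R R} (hΔ : LocNilp Δ) (r : R) : Polynomial R :=
  (exists_expPoly hΔ r).choose

variable {Δ : Derivation k R R} (hΔ : LocNilp Δ)

theorem coeff_expPoly (r : R) (m : ℕ) :
    (expPoly hΔ r).coeff m = (m.factorial : k)⁻¹ • Δ^[m] r :=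
  (exists_expPoly hΔ r).choose_spec m

theorem iterate_add_apply' (m : ℕ) (a b : R) : Δ^[m] (a + b) = Δ^[m] a + Δ^[m] b := by
  induction m generalizing a b with
  | zero => rfl
  | succ m ih => simp only [Function.iterate_succ_apply, map_add, ih]

theorem iterate_sub_apply' (m : ℕ) (a b : R) : Δ^[m] (a - b) = Δ^[m] a - Δ^[m] b := by
  induction m generalizing a b with
  | zero => rfl
  | succ m ih => simp only [Function.iterate_succ_apply, map_sub, ih]

theorem expPoly_add (a b : R) : expPoly hΔ (a + b) = expPoly hΔ a + expPoly hΔ b := by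
  ext m
  simp only [Polynomial.coeff_add, coeff_expPoly, iterate_add_apply', smul_add]

theorem expPoly_of_eq_zero {s : R} (hs : Δ s = 0) : expPoly hΔ s = Polynomial.C s := by
  ext m
  rw [coeff_expPoly]
  rcases m with _ | m
  · simp
  · rw [iterate_eq_zero_of_le Δ (m := 1) (by simpa using hs) (by omega)]
    simp

theorem derivative_expPoly [CharZero k] (a : R) :
    Polynomial.derivative (expPoly hΔ a) = expPoly hΔ (Δ a) := by
  ext m
  rw [Polynomial.coeff_derivative, coeff_expPoly, coeff_expPoly, ← Function.iterate_succ_apply,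
    Nat.factorial_succ]
  have h : ((m : R) + 1) = algebraMap k R ((m : k) + 1) := by simp
  rw [h, mul_comm, ← Algebra.smul_def, smul_smul]
  congr 1
  have : (m : k) + 1 ≠ 0 := by exact_mod_cast Nat.succ_ne_zero m
  have h2 : (m.factorial : k) ≠ 0 := by exact_mod_cast m.factorial_ne_zero
  push_cast
  field_simp

theorem expPoly_mul [CharZero k] (a b : R) :
    expPoly hΔ (a * b) = expPoly hΔ a * expPoly hΔ b := by
  ext m
  induction m generalizing a b with
  | zero => simp [Polynomial.mul_coeff_zero, coeff_expPoly]
  | succ m ih =>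
    have h : (Polynomial.derivative (expPoly hΔ (a * b))).coeff m
        = (expPoly hΔ (Δ (a * b))).coeff m := by rw [derivative_expPoly]
    rw [Polynomial.coeff_derivative] at h
    have h' := congrArg (fun p => Polynomial.coeff p m)
      (Polynomial.derivative_mul (f := expPoly hΔ a) (g := expPoly hΔ b))
    simp only [derivative_expPoly, Polynomial.coeff_add, Polynomial.coeff_derivative] at h'
    rw [Δ.leibniz, expPoly_add, Polynomial.coeff_add, smul_eq_mul, smul_eq_mul, ih, ih,
      mul_comm (expPoly hΔ b)] at h
    replace h := h'.trans ((add_comm _ _).trans h.symm)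
    have hu : IsUnit ((m : R) + 1) := by
      have : ((m : R) + 1) = algebraMap k R ((m : k) + 1) := by simp
      rw [this]
      exact (isUnit_iff_ne_zero.2 (by exact_mod_cast Nat.succ_ne_zero m)).map _
    exact (hu.mul_right_cancel h).symm

/-- The exponential of a locally nilpotent derivation, as an algebra endomorphism. -/
noncomputable def expHom [CharZero k] : R →ₐ[k] R where
  toFun r := (expPoly hΔ r).eval 1
  map_one' := by rw [expPoly_of_eq_zero hΔ Δ.map_one_eq_zero]; simp
  map_mul' a b := by rw [expPoly_mul, Polynomial.eval_mul]
  map_zero' := by rw [expPoly_of_eq_zero hΔ (map_zero Δ)]; simp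
  map_add' a b := by rw [expPoly_add, Polynomial.eval_add]
  commutes' c := by rw [expPoly_of_eq_zero hΔ (Δ.map_algebraMap c)]; simp

variable [CharZero k]

theorem expHom_eq_sum {r : R} {N : ℕ} (h : Δ^[N] r = 0) :
    expHom hΔ r = ∑ m ∈ Finset.range N, (m.factorial : k)⁻¹ • Δ^[m] r := by
  change (expPoly hΔ r).eval 1 = _
  rw [Polynomial.eval_eq_sum_range' (n := N + 1), Finset.sum_range_succ]
  · simp [coeff_expPoly, h]
  · rw [Nat.lt_succ_iff, Polynomial.natDegree_le_iff_coeff_eq_zero]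
    intro m hm
    rw [coeff_expPoly, iterate_eq_zero_of_le Δ h hm.le, smul_zero]

theorem expHom_comm (D : Derivation k R R) (hD : ∀ r, Δ (D r) = D (Δ r)) (r : R) :
    expHom hΔ (D r) = D (expHom hΔ r) := by
  have hit : ∀ m r, Δ^[m] (D r) = D (Δ^[m] r) := by
    intro m
    induction m with
    | zero => intro r; rfl
    | succ m ih => intro r; rw [Function.iterate_succ_apply, hD, ih, ← Function.iterate_succ_apply]
  obtain ⟨N, hN⟩ := hΔ r
  rw [expHom_eq_sum hΔ hN, expHom_eq_sum hΔ (N := N) (by rw [hit, hN, map_zero]), map_sum]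
  exact Finset.sum_congr rfl fun m _ => by rw [hit, D.map_smul]

theorem expHom_iterate (m : ℕ) (r : R) : expHom hΔ (Δ^[m] r) = Δ^[m] (expHom hΔ r) := by
  induction m generalizing r with
  | zero => rfl
  | succ m ih =>
    rw [Function.iterate_succ_apply, Function.iterate_succ_apply, ih,
      expHom_comm hΔ Δ (fun _ => rfl)]

theorem expHom_of_eq_zero {s : R} (hs : Δ s = 0) : expHom hΔ s = s := by
  change (expPoly hΔ s).eval 1 = s
  rw [expPoly_of_eq_zero hΔ hs, Polynomial.eval_C]

theorem expHom_bijective : Function.Bijective (expHom hΔ) := by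
  have key : ∀ N r, Δ^[N + 1] r = 0 → Δ^[N] (expHom hΔ r) = Δ^[N] r := by
    intro N r h
    rw [← expHom_iterate]
    exact expHom_of_eq_zero hΔ (by rwa [← Function.iterate_succ_apply' (f := Δ)])
  constructor
  · rw [injective_iff_map_eq_zero]
    intro r hr
    obtain ⟨N, hN⟩ := hΔ r
    induction N with
    | zero => exact hN
    | succ N ih =>
      refine ih ?_
      rw [← key N r hN, hr]
      exact Function.iterate_fixed (map_zero Δ) N
  · intro r
    obtain ⟨N, hN⟩ := hΔ r
    induction N generalizing r with
    | zero => exact ⟨0, by rw [map_zero]; exact hN.symm⟩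
    | succ N ih =>
      obtain ⟨s, hs⟩ := ih (expHom hΔ r - r) (by rw [iterate_sub_apply', key N r hN, sub_self])
      exact ⟨r - s, by rw [map_sub, hs]; ring⟩

theorem eq_zero_of_expHom_eq_id (h : ∀ r, expHom hΔ r = r) : Δ = 0 := by
  ext r
  obtain ⟨N, hN⟩ := hΔ r
  have : ∀ N, Δ^[N + 1] r = 0 → Δ r = 0 := by
    intro N
    induction N with
    | zero => exact id
    | succ N ih =>
      intro hN
      refine ih ?_
      have h2 := h (Δ^[N] r)
      rw [expHom_eq_sum hΔ (N := 2)
        (by rw [← Function.iterate_add_apply, add_comm]; exact hN)] at h2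
      simpa [Finset.sum_range_succ, ← Function.iterate_succ_apply' (f := Δ)] using h2
  exact this N (iterate_eq_zero_of_le Δ hN (by omega))

end Exponential

/-- The properties of a derivation `D` with a marked element `x` that propagate along the
extensions `D + g(x) ∂_y`: only constants have image in the polynomials in `x` of degree at most
`l`, while the locally nilpotent derivations and the automorphisms commuting with `D` are
determined by their effect on `x`, which is a translation. -/
structure Rigid {k R : Type*} [Field k] [CommRing R] [Algebra k R] (l : ℕ∞)
    (D : Derivation k R R) (x : R) : Prop where
  image : ∀ (r : R) (p : Polynomial k), (p.natDegree : ℕ∞) ≤ l → D r = Polynomial.aeval x p →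
    (∃ c : k, r = algebraMap k R c) ∧ p = 0
  nilp : ∀ Δ : Derivation k R R, LocNilp Δ → (∀ r, Δ (D r) = D (Δ r)) →
    ∃ c : k, Δ x = algebraMap k R c ∧ (c = 0 → Δ = 0)
  isotropy : ∀ σ : R ≃ₐ[k] R, (∀ r, σ (D r) = D (σ r)) →
    ∃ e : k, σ x = x + algebraMap k R e ∧ (e = 0 → σ = AlgEquiv.refl)

section PolynomialDerivation

variable {k R : Type*} [Field k] [CommRing R] [Algebra k R]

/-- The `m`-th coefficient of a derivation of `R[X]`, as a derivation of `R`. -/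
noncomputable def coeffDer (δ : Derivation k (Polynomial R) (Polynomial R)) (m : ℕ) :
    Derivation k R R :=
  Derivation.mk'
    ((Polynomial.lcoeff R m).restrictScalars k ∘ₗ (δ : Polynomial R →ₗ[k] Polynomial R) ∘ₗ
      (Polynomial.CAlgHom (R := k) (A := R)).toLinearMap)
    (fun a b => by simp [Polynomial.coeff_C_mul])

theorem coeffDer_apply (δ : Derivation k (Polynomial R) (Polynomial R)) (m : ℕ) (r : R) :
    coeffDer δ m r = (δ (Polynomial.C r)).coeff m := rfl

theorem ext_of_C_X {δ ε : Derivation k (Polynomial R) (Polynomial R)}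
    (hC : ∀ r, δ (Polynomial.C r) = ε (Polynomial.C r)) (hX : δ Polynomial.X = ε Polynomial.X) :
    δ = ε := by
  ext1 f
  induction f using Polynomial.induction_on' with
  | add p q hp hq => rw [map_add, map_add, hp, hq]
  | monomial n a =>
    rw [← Polynomial.C_mul_X_pow_eq_monomial, δ.leibniz, ε.leibniz, δ.leibniz_pow,
      ε.leibniz_pow, hC, hX]

theorem apply_C_mul_X_pow (δ : Derivation k (Polynomial R) (Polynomial R)) (a : R) (j : ℕ) :
    δ (Polynomial.C a * Polynomial.X ^ j) = δ (Polynomial.C a) * Polynomial.X ^ j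
      + Polynomial.C (j * a) * (δ Polynomial.X * Polynomial.X ^ (j - 1)) := by
  simp only [Derivation.leibniz, Derivation.leibniz_pow, smul_eq_mul, nsmul_eq_mul, map_mul,
    map_natCast]
  ring

theorem coeff_top {δ : Derivation k (Polynomial R) (Polynomial R)} {M : ℕ}
    (hM : ∀ r, (δ (Polynomial.C r)).natDegree ≤ M) (hX : (δ Polynomial.X).natDegree ≤ M + 1)
    {f : Polynomial R} {e : ℕ} (hf : f.natDegree ≤ e) :
    (δ f).natDegree ≤ e + M ∧ (δ f).coeff (e + M) =
      coeffDer δ M (f.coeff e) + e * f.coeff e * (δ Polynomial.X).coeff (M + 1) := by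
  refine Polynomial.induction_with_natDegree_le (fun f => (δ f).natDegree ≤ e + M ∧
    (δ f).coeff (e + M) = coeffDer δ M (f.coeff e) +
      e * f.coeff e * (δ Polynomial.X).coeff (M + 1)) e (by simp) ?_ ?_ f hf
  rotate_left
  · intro f g _ _ ihf ihg
    rw [map_add, Polynomial.coeff_add, Polynomial.coeff_add, ihf.2, ihg.2, map_add]
    exact ⟨Polynomial.natDegree_add_le_of_degree_le ihf.1 ihg.1, by ring⟩
  · intro j a _ hj
    rw [apply_C_mul_X_pow, coeffDer_apply]
    rcases Nat.eq_zero_or_pos j with rfl | hj0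
    · simp only [pow_zero, mul_one, Nat.cast_zero, zero_mul, map_zero, add_zero]
      refine ⟨(hM a).trans (by omega), ?_⟩
      rcases Nat.eq_zero_or_pos e with rfl | he
      · simp
      · rw [Polynomial.coeff_eq_zero_of_natDegree_lt ((hM a).trans_lt (by omega)),
          Polynomial.coeff_C_of_ne_zero (by omega)]
        simp
    have h1 : (δ (Polynomial.C a) * Polynomial.X ^ j).natDegree ≤ j + M :=
      Polynomial.natDegree_mul_le.trans (by
        have := hM a
        have := Polynomial.natDegree_X_pow_le (R := R) j
        omega)
    have h2 : (Polynomial.C (j * a) * (δ Polynomial.X * Polynomial.X ^ (j - 1))).natDegree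
        ≤ j + M :=
      (Polynomial.natDegree_C_mul_le _ _).trans (Polynomial.natDegree_mul_le.trans (by
        have := Polynomial.natDegree_X_pow_le (R := R) (j - 1)
        omega))
    have h3 := Polynomial.natDegree_add_le_of_degree_le h1 h2
    refine ⟨h3.trans (by omega), ?_⟩
    rcases hj.lt_or_eq with hlt | rfl
    · rw [Polynomial.coeff_eq_zero_of_natDegree_lt (h3.trans_lt (by omega)),
        Polynomial.coeff_C_mul_X_pow, if_neg (by omega)]
      simp
    · rw [Polynomial.coeff_add, Polynomial.coeff_C_mul, add_comm j M, Polynomial.coeff_mul_X_pow,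
        show M + j = (M + 1) + (j - 1) by omega, Polynomial.coeff_mul_X_pow,
        Polynomial.coeff_C_mul_X_pow, if_pos rfl]

theorem exists_natDegree_bound [Algebra.FiniteType k R]
    (δ : Derivation k (Polynomial R) (Polynomial R)) :
    ∃ M, ∀ r, (δ (Polynomial.C r)).natDegree ≤ M := by
  obtain ⟨s, hs⟩ := Algebra.FiniteType.out (R := k) (A := R)
  refine ⟨s.sup fun r => (δ (Polynomial.C r)).natDegree, fun r => ?_⟩
  have hr : r ∈ Algebra.adjoin k (s : Set R) := by rw [hs]; trivial
  induction hr using Algebra.adjoin_induction with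
  | mem r hr => exact Finset.le_sup (f := fun r => (δ (Polynomial.C r)).natDegree) hr
  | algebraMap c =>
    rw [← Polynomial.algebraMap_apply, δ.map_algebraMap]
    simp
  | add a b _ _ ha hb =>
    rw [Polynomial.C_add, map_add]
    exact Polynomial.natDegree_add_le_of_degree_le ha hb
  | mul a b _ _ ha hb =>
    rw [Polynomial.C_mul, δ.leibniz]
    exact Polynomial.natDegree_add_le_of_degree_le
      ((Polynomial.natDegree_C_mul_le _ _).trans hb) ((Polynomial.natDegree_C_mul_le _ _).trans ha)

theorem exists_top_coeffDer [Algebra.FiniteType k R]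
    (δ : Derivation k (Polynomial R) (Polynomial R)) (h : ∃ r, δ (Polynomial.C r) ≠ 0) :
    ∃ M, (∀ r, (δ (Polynomial.C r)).natDegree ≤ M) ∧ coeffDer δ M ≠ 0 := by
  classical
  have hex := exists_natDegree_bound δ
  refine ⟨Nat.find hex, Nat.find_spec hex, fun h0 => ?_⟩
  have hz : ∀ r, (δ (Polynomial.C r)).coeff (Nat.find hex) = 0 := fun r => by
    rw [← coeffDer_apply, h0, Derivation.zero_apply]
  have hlt : ∀ r, ∀ m, Nat.find hex ≤ m → (δ (Polynomial.C r)).coeff m = 0 := fun r m hm => by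
    rcases hm.lt_or_eq with hm | rfl
    · exact Polynomial.coeff_eq_zero_of_natDegree_lt ((Nat.find_spec hex r).trans_lt hm)
    · exact hz r
  rcases hN : Nat.find hex with _ | N
  · obtain ⟨r, hr⟩ := h
    refine hr (Polynomial.ext fun m => ?_)
    rw [hlt r m (by omega), Polynomial.coeff_zero]
  · refine Nat.find_min hex (m := N) (by omega) fun r => ?_
    rw [Polynomial.natDegree_le_iff_coeff_eq_zero]
    exact fun m hm => hlt r m (by omega)

/-- The top coefficient of a locally nilpotent derivation of `R[X]` is locally nilpotent. -/
theorem locNilp_top [CharZero k] [Nontrivial R] {δ : Derivation k (Polynomial R) (Polynomial R)}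
    (hδ : LocNilp δ) {M : ℕ} (hM : ∀ r, (δ (Polynomial.C r)).natDegree ≤ M)
    (hX : (δ Polynomial.X).natDegree ≤ M + 1) {β : k}
    (hβ : (δ Polynomial.X).coeff (M + 1) = algebraMap k R β) :
    β = 0 ∧ LocNilp (coeffDer δ M) := by
  have hβ0 : β = 0 := by
    by_contra hne
    have key : ∀ s, ∃ c : k, c ≠ 0 ∧ (δ^[s] Polynomial.X).natDegree ≤ 1 + s * M ∧
        (δ^[s] Polynomial.X).coeff (1 + s * M) = algebraMap k R c := by
      intro s
      induction s with
      | zero => exact ⟨1, one_ne_zero, by simp, by simp⟩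
      | succ s ih =>
        obtain ⟨c, hc, hd, hco⟩ := ih
        have ht := coeff_top hM hX hd
        refine ⟨(1 + s * M : ℕ) * c * β, mul_ne_zero (mul_ne_zero ?_ hc) hne, ?_, ?_⟩
        · exact_mod_cast (by omega : 1 + s * M ≠ 0)
        · rw [Function.iterate_succ_apply']
          exact ht.1.trans (by rw [Nat.succ_mul]; omega)
        · rw [Function.iterate_succ_apply', Nat.succ_mul, ← add_assoc, ht.2, hco, hβ,
            Derivation.map_algebraMap]
          simp
    obtain ⟨s, hs⟩ := hδ Polynomial.X
    obtain ⟨c, hc, -, h⟩ := key s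
    rw [hs, Polynomial.coeff_zero] at h
    exact hc ((map_eq_zero (algebraMap k R)).1 h.symm)
  subst hβ0
  refine ⟨rfl, fun r => ?_⟩
  have key : ∀ s, (δ^[s] (Polynomial.C r)).natDegree ≤ s * M ∧
      (δ^[s] (Polynomial.C r)).coeff (s * M) = (coeffDer δ M)^[s] r := by
    intro s
    induction s with
    | zero => simp
    | succ s ih =>
      have ht := coeff_top hM hX ih.1
      rw [Function.iterate_succ_apply', Function.iterate_succ_apply', Nat.succ_mul, ht.2, ih.2, hβ]
      exact ⟨ht.1, by simp⟩
  obtain ⟨s, hs⟩ := hδ (Polynomial.C r)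
  exact ⟨s, by rw [← (key s).2, hs, Polynomial.coeff_zero]⟩

end PolynomialDerivation

section Extension

variable {k R : Type*} [Field k] [CommRing R] [Algebra k R]
  {l : ℕ∞} {D : Derivation k R R} {x : R} {g : Polynomial k}
  {D' : Derivation k (Polynomial R) (Polynomial R)}

theorem coeff_extension (hC : ∀ r, D' (Polynomial.C r) = Polynomial.C (D r))
    (hX : D' Polynomial.X = Polynomial.C (Polynomial.aeval x g)) (f : Polynomial R) (m : ℕ) :
    (D' f).coeff m = D (f.coeff m) + ((m + 1 : ℕ) : R) * f.coeff (m + 1) * Polynomial.aeval x g := by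
  induction f using Polynomial.induction_on' with
  | add p q hp hq =>
    rw [map_add, Polynomial.coeff_add, Polynomial.coeff_add, Polynomial.coeff_add, hp, hq, map_add]
    ring
  | monomial n a =>
    rw [← Polynomial.C_mul_X_pow_eq_monomial, apply_C_mul_X_pow, hC, hX, Polynomial.coeff_add,
      Polynomial.coeff_C_mul_X_pow, Polynomial.coeff_C_mul, Polynomial.coeff_C_mul,
      Polynomial.coeff_X_pow, Polynomial.coeff_C_mul_X_pow, Polynomial.coeff_C_mul_X_pow]
    rcases n with _ | n
    · by_cases h : m = 0 <;> simp [h]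
    · by_cases h : m = n + 1
      · subst h; simp
      · by_cases h' : m = n
        · subst h'; simp
        · simp [h, h']

theorem coeff_const_of_image [CharZero k] (hR : Rigid l D x) (hg : 0 < g.natDegree)
    (hgl : (g.natDegree : ℕ∞) ≤ l) {f : Polynomial R} {M : ℕ}
    (h : ∀ m, M ≤ m → ∃ a : k,
      D (f.coeff m) + ((m + 1 : ℕ) : R) * f.coeff (m + 1) * Polynomial.aeval x g
        = algebraMap k R a) :
    f.natDegree ≤ M ∧ ∃ c : k, f.coeff M = algebraMap k R c := by
  have htop : ∀ m, M ≤ m → f.coeff (m + 1) = 0 → ∃ c : k, f.coeff m = algebraMap k R c := by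
    intro m hm h0
    obtain ⟨a, ha⟩ := h m hm
    exact (hR.image (f.coeff m) (Polynomial.C a) (by simp) (by simpa [h0] using ha)).1
  have hd : f.natDegree ≤ M := by
    by_contra! hlt
    obtain ⟨N, hN⟩ : ∃ N, f.natDegree = N + 1 := ⟨f.natDegree - 1, by omega⟩
    obtain ⟨c, hc⟩ := htop (N + 1) (by omega)
      (Polynomial.coeff_eq_zero_of_natDegree_lt (by omega))
    obtain ⟨a, ha⟩ := h N (by omega)
    have hp := (hR.image (f.coeff N)
      (Polynomial.C a - Polynomial.C ((N + 1 : ℕ) * c) * g) ?_ ?_).2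
    · have h1 := congrArg (fun p => Polynomial.coeff p g.natDegree) hp
      simp only [Polynomial.coeff_sub, Polynomial.coeff_C_mul, Polynomial.coeff_zero,
        Polynomial.coeff_C_of_ne_zero hg.ne', zero_sub, neg_eq_zero, mul_eq_zero,
        Nat.cast_eq_zero, Polynomial.coeff_natDegree, Polynomial.leadingCoeff_eq_zero] at h1
      rcases h1 with (h1 | h1) | h1
      · omega
      · have : f.leadingCoeff = 0 := by
          rw [Polynomial.leadingCoeff, hN, hc, h1, map_zero]
        rw [Polynomial.leadingCoeff_eq_zero] at this
        simp [this] at hN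
      · simp [h1] at hg
    · refine le_trans ?_ hgl
      exact_mod_cast (Polynomial.natDegree_sub_le_of_le (m := 0) (n := g.natDegree) (by simp)
        (Polynomial.natDegree_C_mul_le _ _)).trans (by simp)
    · rw [hc] at ha
      simp only [map_sub, map_mul, Polynomial.aeval_C, map_natCast]
      rw [← ha]
      ring
  exact ⟨hd, htop M le_rfl (Polynomial.coeff_eq_zero_of_natDegree_lt (by omega))⟩

theorem image_extension [CharZero k] [Nontrivial R] (hR : Rigid l D x) (hg : 0 < g.natDegree) (hgl : (g.natDegree : ℕ∞) ≤ l)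
    (hC : ∀ r, D' (Polynomial.C r) = Polynomial.C (D r))
    (hX : D' Polynomial.X = Polynomial.C (Polynomial.aeval x g)) {f : Polynomial R}
    {p : Polynomial k} (h : D' f = Polynomial.aeval Polynomial.X p) :
    (∃ c : k, f = algebraMap k (Polynomial R) c) ∧ p = 0 := by
  have hp : ∀ q : Polynomial k,
      Polynomial.aeval (Polynomial.X : Polynomial R) q = q.map (algebraMap k R) := fun q => by
    rw [Polynomial.aeval_X_left_eq_map]
  obtain ⟨hd, c, hc⟩ := coeff_const_of_image (f := f) (M := 0) hR hg hgl fun m _ =>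
    ⟨p.coeff m, by rw [← coeff_extension hC hX, h, hp, Polynomial.coeff_map]⟩
  have hf : f = algebraMap k (Polynomial R) c := by
    rw [Polynomial.eq_C_of_natDegree_le_zero hd, hc, Polynomial.algebraMap_apply]
  refine ⟨⟨c, hf⟩, ?_⟩
  rw [hf, D'.map_algebraMap, hp] at h
  exact (Polynomial.map_eq_zero (algebraMap k R)).1 h.symm

theorem nilp_extension [CharZero k] [Nontrivial R] [Algebra.FiniteType k R] (hR : Rigid l D x) (hg : 0 < g.natDegree)
    (hgl : (g.natDegree : ℕ∞) ≤ l)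
    (hC : ∀ r, D' (Polynomial.C r) = Polynomial.C (D r))
    (hX : D' Polynomial.X = Polynomial.C (Polynomial.aeval x g))
    {δ : Derivation k (Polynomial R) (Polynomial R)} (hδ : LocNilp δ)
    (hcomm : ∀ f, δ (D' f) = D' (δ f)) :
    (∀ r, δ (Polynomial.C r) = 0) ∧
      ∃ c : k, δ Polynomial.X = algebraMap k (Polynomial R) c := by
  have hb : D' (δ Polynomial.X) = δ (Polynomial.C (Polynomial.aeval x g)) := by
    rw [← hX, hcomm]
  by_cases hz : ∀ r, δ (Polynomial.C r) = 0
  · refine ⟨hz, ?_⟩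
    exact (image_extension (p := 0) hR hg hgl hC hX (by rw [hb, hz, map_zero])).1
  exfalso
  push Not at hz
  obtain ⟨M, hM, hne⟩ := exists_top_coeffDer δ hz
  have hco : ∀ m, D ((δ Polynomial.X).coeff m) +
      ((m + 1 : ℕ) : R) * (δ Polynomial.X).coeff (m + 1) * Polynomial.aeval x g
        = coeffDer δ m (Polynomial.aeval x g) := fun m => by
    rw [← coeff_extension hC hX, hb, coeffDer_apply]
  have hbig : ∀ r m, M < m → (δ (Polynomial.C r)).coeff m = 0 := fun r m hm =>
    Polynomial.coeff_eq_zero_of_natDegree_lt ((hM r).trans_lt hm)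
  obtain ⟨hdX, β, hβ⟩ := coeff_const_of_image (f := δ Polynomial.X) (M := M + 1) hR hg hgl
    fun m hm => ⟨0, by rw [hco, coeffDer_apply, hbig _ m (by omega), map_zero]⟩
  obtain ⟨rfl, hnil⟩ := locNilp_top hδ hM hdX hβ
  obtain ⟨c, hc, hc0⟩ := hR.nilp _ hnil fun r => by
    have := congrArg (fun f => Polynomial.coeff f M) (hcomm (Polynomial.C r))
    simp only [hC, coeff_extension hC hX, hbig r (M + 1) (by omega)] at this
    simpa [coeffDer_apply] using this
  have h1 := hco M
  rw [hβ, Derivation.map_aeval, hc, map_zero, mul_zero, zero_mul, add_zero, smul_eq_mul,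
    ← Polynomial.aeval_C (R := k) x, ← map_mul] at h1
  have h2 := (hR.image _ (Polynomial.derivative g * Polynomial.C c) (le_trans (by
    exact_mod_cast (Polynomial.natDegree_mul_C_le _ _).trans
      ((Polynomial.natDegree_derivative_le g).trans (Nat.sub_le _ _))) hgl) h1).2
  rcases mul_eq_zero.1 h2 with h3 | h3
  · exact hg.ne' (Polynomial.derivative_eq_zero.1 h3)
  · exact hne (hc0 (by simpa using h3))

theorem eq_of_derivative_eq_C [CharZero k] {f : Polynomial R} {s : R}
    (h : Polynomial.derivative f = Polynomial.C s) :
    f = Polynomial.C s * Polynomial.X + Polynomial.C (f.coeff 0) := by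
  ext m
  rw [Polynomial.coeff_add, Polynomial.coeff_C_mul, Polynomial.coeff_X, Polynomial.coeff_C]
  rcases m with _ | m
  · simp
  have h1 := congrArg (fun p => Polynomial.coeff p m) h
  simp only [Polynomial.coeff_derivative, Polynomial.coeff_C] at h1
  rcases m with _ | m
  · simpa using h1
  have hu : IsUnit (((m + 1 : ℕ) : R) + 1) := by
    have : (((m + 1 : ℕ) : R) + 1) = algebraMap k R ((m + 1 : ℕ) + 1) := by simp
    rw [this]
    exact (isUnit_iff_ne_zero.2 (by exact_mod_cast Nat.succ_ne_zero (m + 1))).map _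
  have h2 : f.coeff (m + 1 + 1) = 0 := hu.mul_left_eq_zero.1 (by simpa using h1)
  simp [h2]

theorem eq_zero_of_comp_X_add_C [CharZero k] {e : k} (hg : 0 < g.natDegree)
    (h : g.comp (Polynomial.X + Polynomial.C e) = g) : e = 0 := by
  by_contra he
  have hev : ∀ m : ℕ, g.eval (m * e) = g.eval 0 := by
    intro m
    induction m with
    | zero => simp
    | succ m ih =>
      rw [← ih]
      conv_rhs => rw [← h]
      simp [Polynomial.eval_comp, add_mul]
  have : g = Polynomial.C (g.eval 0) := by
    refine Polynomial.eq_of_infinite_eval_eq _ _ (Set.Infinite.mono ?_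
      (Set.infinite_range_of_injective (f := fun m : ℕ => (m : k) * e) ?_))
    · rintro _ ⟨m, rfl⟩
      simpa using hev m
    · intro a b hab
      exact_mod_cast mul_right_cancel₀ he hab
  rw [this, Polynomial.natDegree_C] at hg
  exact hg.false

/-- A derivation transported along an algebra isomorphism. -/
def conjDer {S : Type*} [CommRing S] [Algebra k S] (e : R ≃ₐ[k] S) (D : Derivation k R R) :
    Derivation k S S :=
  Derivation.mk' (e.toLinearMap ∘ₗ (D : R →ₗ[k] R) ∘ₗ e.symm.toLinearMap) (fun a b => by simp)

theorem conjDer_apply {S : Type*} [CommRing S] [Algebra k S] (e : R ≃ₐ[k] S)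
    (D : Derivation k R R) (s : S) : conjDer e D s = e (D (e.symm s)) := rfl

theorem conjDer_iterate {S : Type*} [CommRing S] [Algebra k S] (e : R ≃ₐ[k] S)
    (D : Derivation k R R) (m : ℕ) (s : S) : (conjDer e D)^[m] s = e (D^[m] (e.symm s)) := by
  induction m generalizing s with
  | zero => simp
  | succ m ih => simp [ih, conjDer_apply]

theorem LocNilp.conj {S : Type*} [CommRing S] [Algebra k S] (e : R ≃ₐ[k] S)
    {D : Derivation k R R} (h : LocNilp D) : LocNilp (conjDer e D) := fun s => by
  obtain ⟨m, hm⟩ := h (e.symm s)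
  exact ⟨m, by rw [conjDer_iterate, hm, map_zero]⟩

/-- The formal derivative of `R[X]`, as a `k`-derivation. -/
noncomputable def derivativeDer (k R : Type*) [Field k] [CommRing R] [Algebra k R] :
    Derivation k (Polynomial R) (Polynomial R) :=
  Derivation.restrictScalars k (Polynomial.derivative' (R := R))

theorem derivativeDer_apply (f : Polynomial R) :
    derivativeDer k R f = Polynomial.derivative f := rfl

theorem locNilp_derivativeDer : LocNilp (derivativeDer k R) := fun f =>
  ⟨f.natDegree + 1, Polynomial.iterate_derivative_eq_zero (Nat.lt_succ_self _)⟩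

theorem derivativeDer_comm (hC : ∀ r, D' (Polynomial.C r) = Polynomial.C (D r))
    (hX : D' Polynomial.X = Polynomial.C (Polynomial.aeval x g)) (f : Polynomial R) :
    derivativeDer k R (D' f) = D' (derivativeDer k R f) := by
  ext m
  have h : ∀ (a : R) (q : ℕ), D (a * (q + 1)) = D a * (q + 1) := fun a q => by
    have := D.map_natCast (q + 1)
    push_cast at this
    rw [D.leibniz, this, smul_zero, zero_add, smul_eq_mul, mul_comm]
  rw [derivativeDer_apply, derivativeDer_apply, Polynomial.coeff_derivative,
    coeff_extension hC hX, coeff_extension hC hX, Polynomial.coeff_derivative,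
    Polynomial.coeff_derivative, h]
  push_cast
  ring

theorem exists_image_C_X [CharZero k] [Nontrivial R] [Algebra.FiniteType k R] (hR : Rigid l D x)
    (hg : 0 < g.natDegree) (hgl : (g.natDegree : ℕ∞) ≤ l)
    (hC : ∀ r, D' (Polynomial.C r) = Polynomial.C (D r))
    (hX : D' Polynomial.X = Polynomial.C (Polynomial.aeval x g))
    (ρ : Polynomial R ≃ₐ[k] Polynomial R) (hρ : ∀ f, ρ (D' f) = D' (ρ f)) :
    (∀ r, ∃ s, ρ (Polynomial.C r) = Polynomial.C s) ∧ ∃ (a : k) (r₀ : R),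
      ρ Polynomial.X = algebraMap k (Polynomial R) a * Polynomial.X + Polynomial.C r₀ := by
  have hρ' : ∀ f, ρ.symm (D' f) = D' (ρ.symm f) := fun f => by
    rw [AlgEquiv.symm_apply_eq, hρ, AlgEquiv.apply_symm_apply]
  obtain ⟨hδC, c, hδX⟩ := nilp_extension hR hg hgl hC hX
    (locNilp_derivativeDer.conj ρ) (fun f => by
      rw [conjDer_apply, conjDer_apply, hρ', derivativeDer_comm hC hX, hρ])
  have hδ : conjDer ρ (derivativeDer k R) = c • derivativeDer k R := by
    refine ext_of_C_X (fun r => ?_) ?_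
    · rw [hδC, Derivation.smul_apply, derivativeDer_apply, Polynomial.derivative_C, smul_zero]
    · rw [hδX, Derivation.smul_apply, derivativeDer_apply, Polynomial.derivative_X,
        Algebra.smul_def, mul_one]
  have key : ∀ f, c • Polynomial.derivative (ρ f) = ρ (Polynomial.derivative f) := fun f => by
    have := congrArg (fun d => d (ρ f)) hδ
    simpa [conjDer_apply, derivativeDer_apply] using this.symm
  have hkX := key Polynomial.X
  rw [Polynomial.derivative_X, map_one] at hkX
  have hc : c ≠ 0 := by
    rintro rfl
    simp at hkX
  refine ⟨fun r => ?_, c⁻¹, (ρ Polynomial.X).coeff 0, ?_⟩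
  · have h0 : Polynomial.derivative (ρ (Polynomial.C r)) = Polynomial.C 0 := by
      have := key (Polynomial.C r)
      rw [Polynomial.derivative_C, map_zero] at this
      rw [map_zero]
      exact (smul_eq_zero_iff_right hc).1 this
    exact ⟨_, by simpa using eq_of_derivative_eq_C (k := k) h0⟩
  · rw [Polynomial.algebraMap_apply]
    refine eq_of_derivative_eq_C (k := k) ?_
    rw [← Polynomial.algebraMap_apply, Algebra.algebraMap_eq_smul_one, ← hkX, smul_smul,
      inv_mul_cancel₀ hc, one_smul]

theorem isotropy_extension [CharZero k] [Nontrivial R] [Algebra.FiniteType k R] (hR : Rigid l D x)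
    (hg : 0 < g.natDegree) (hgl : (g.natDegree : ℕ∞) ≤ l)
    (hC : ∀ r, D' (Polynomial.C r) = Polynomial.C (D r))
    (hX : D' Polynomial.X = Polynomial.C (Polynomial.aeval x g))
    (ρ : Polynomial R ≃ₐ[k] Polynomial R) (hρ : ∀ f, ρ (D' f) = D' (ρ f)) :
    (∀ r, ρ (Polynomial.C r) = Polynomial.C r) ∧ ∃ c : k,
      ρ Polynomial.X = Polynomial.X + algebraMap k (Polynomial R) c := by
  have hρ' : ∀ f, ρ.symm (D' f) = D' (ρ.symm f) := fun f => by
    rw [AlgEquiv.symm_apply_eq, hρ, AlgEquiv.apply_symm_apply]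
  obtain ⟨h1, a, r₀, h2⟩ := exists_image_C_X hR hg hgl hC hX ρ hρ
  obtain ⟨h1', -⟩ := exists_image_C_X hR hg hgl hC hX ρ.symm hρ'
  let z : Polynomial R →ₐ[k] R := (Polynomial.aeval (R := R) (0 : R)).restrictScalars k
  have hz : ∀ r, z (Polynomial.C r) = r := fun r => Polynomial.aeval_C (R := R) (0 : R) r
  let τ : (Polynomial R ≃ₐ[k] Polynomial R) → (R →ₐ[k] R) := fun θ =>
    (z.comp (θ : Polynomial R →ₐ[k] Polynomial R)).comp Polynomial.CAlgHom
  have hτ : ∀ r, Polynomial.C (τ ρ r) = ρ (Polynomial.C r) := fun r => by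
    obtain ⟨s, hs⟩ := h1 r
    change Polynomial.C (z (ρ (Polynomial.C r))) = _
    rw [hs, hz]
  have hτ' : ∀ r, Polynomial.C (τ ρ.symm r) = ρ.symm (Polynomial.C r) := fun r => by
    obtain ⟨s, hs⟩ := h1' r
    change Polynomial.C (z (ρ.symm (Polynomial.C r))) = _
    rw [hs, hz]
  let σ : R ≃ₐ[k] R := AlgEquiv.ofAlgHom (τ ρ) (τ ρ.symm)
    (AlgHom.ext fun r => Polynomial.C_injective (by
      change Polynomial.C (τ ρ (τ ρ.symm r)) = Polynomial.C r
      rw [hτ, hτ', AlgEquiv.apply_symm_apply]))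
    (AlgHom.ext fun r => Polynomial.C_injective (by
      change Polynomial.C (τ ρ.symm (τ ρ r)) = Polynomial.C r
      rw [hτ', hτ, AlgEquiv.symm_apply_apply]))
  have hσ : ∀ r, Polynomial.C (σ r) = ρ (Polynomial.C r) := hτ
  obtain ⟨e, he, he0⟩ := hR.isotropy σ fun r => Polynomial.C_injective (by
    rw [hσ, ← hC, hρ, ← hσ, hC])
  have hcomp : Polynomial.aeval x (g.comp (Polynomial.X + Polynomial.C e)) =
      σ (Polynomial.aeval x g) := by
    rw [Polynomial.aeval_comp, ← Polynomial.aeval_algHom_apply, he]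
    simp
  have hD : D r₀ = Polynomial.aeval x
      (g.comp (Polynomial.X + Polynomial.C e) - Polynomial.C a * g) := by
    refine Polynomial.C_injective ?_
    have h3 := hρ Polynomial.X
    rw [h2, hX, ← hσ, map_add, hC, ← Algebra.smul_def, D'.map_smul, hX] at h3
    rw [map_sub, hcomp, map_sub, h3, map_mul, Polynomial.aeval_C, Algebra.smul_def, map_mul,
      Polynomial.algebraMap_apply]
    ring
  have hdeg : (g.comp (Polynomial.X + Polynomial.C e)).natDegree = g.natDegree := by
    rw [Polynomial.natDegree_comp, Polynomial.natDegree_X_add_C, mul_one]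
  have hdeg' := Polynomial.natDegree_sub_le_of_le (n := g.natDegree) hdeg.le
    (Polynomial.natDegree_C_mul_le a g)
  rw [max_self] at hdeg'
  obtain ⟨⟨c, hc⟩, h0⟩ := hR.image r₀ _ (le_trans (by exact_mod_cast hdeg') hgl) hD
  rw [sub_eq_zero] at h0
  have ha : a = 1 := by
    have h4 := congrArg Polynomial.leadingCoeff h0
    rw [Polynomial.leadingCoeff_comp (by simp), Polynomial.leadingCoeff_X_add_C, one_pow, mul_one,
      Polynomial.leadingCoeff_mul, Polynomial.leadingCoeff_C] at h4
    have hl : g.leadingCoeff ≠ 0 := by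
      rw [Ne, Polynomial.leadingCoeff_eq_zero]
      rintro rfl
      simp at hg
    exact mul_right_cancel₀ hl (by rw [← h4, one_mul])
  subst ha
  have hid := he0 (eq_zero_of_comp_X_add_C hg (by simpa using h0))
  refine ⟨fun r => by rw [← hσ, hid]; rfl, c, ?_⟩
  rw [h2, hc, map_one, one_mul, Polynomial.algebraMap_apply]

theorem Rigid.extension [CharZero k] [Nontrivial R] [Algebra.FiniteType k R] (hR : Rigid l D x)
    (hg : 0 < g.natDegree) (hgl : (g.natDegree : ℕ∞) ≤ l)
    (hC : ∀ r, D' (Polynomial.C r) = Polynomial.C (D r))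
    (hX : D' Polynomial.X = Polynomial.C (Polynomial.aeval x g)) :
    Rigid ⊤ D' Polynomial.X where
  image _ _ _ h := image_extension hR hg hgl hC hX h
  nilp δ hδ hcomm := by
    obtain ⟨h1, c, hc⟩ := nilp_extension hR hg hgl hC hX hδ hcomm
    refine ⟨c, hc, ?_⟩
    rintro rfl
    exact ext_of_C_X h1 (by rw [hc, map_zero, Derivation.zero_apply])
  isotropy ρ hρ := by
    obtain ⟨h1, c, hc⟩ := isotropy_extension hR hg hgl hC hX ρ hρ
    refine ⟨c, hc, ?_⟩
    rintro rfl
    rw [map_zero, add_zero] at hc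
    refine AlgEquiv.ext fun f => ?_
    induction f using Polynomial.induction_on' with
    | add p q hp hq => rw [map_add, hp, hq, map_add]
    | monomial n a =>
      rw [← Polynomial.C_mul_X_pow_eq_monomial, map_mul, map_pow, h1, hc]; rfl

theorem Rigid.congr {S : Type*} [CommRing S] [Algebra k S] (e : R ≃ₐ[k] S)
    {E : Derivation k S S} (hE : ∀ r, E (e r) = e (D r)) (hR : Rigid l D x) :
    Rigid l E (e x) where
  image s p hp h := by
    have hD : D (e.symm s) = Polynomial.aeval x p := by
      apply e.injective
      rw [← hE, AlgEquiv.apply_symm_apply, h, Polynomial.aeval_algHom_apply]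
    obtain ⟨⟨c, hc⟩, h0⟩ := hR.image _ p hp hD
    exact ⟨⟨c, by rw [← e.apply_symm_apply s, hc, e.commutes]⟩, h0⟩
  nilp Δ hΔ hcomm := by
    obtain ⟨c, hc, hc0⟩ := hR.nilp (conjDer e.symm Δ) (hΔ.conj e.symm) fun r => by
      apply e.injective
      simp only [conjDer_apply, AlgEquiv.symm_symm, ← hE, hcomm, AlgEquiv.apply_symm_apply]
    refine ⟨c, ?_, fun h => ?_⟩
    · have := congrArg e hc
      simpa [conjDer_apply] using this
    · ext s
      have := congrArg (fun d => e (d (e.symm s))) (hc0 h)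
      simpa [conjDer_apply] using this
  isotropy σ hσ := by
    obtain ⟨c, hc, hc0⟩ := hR.isotropy ((e.trans σ).trans e.symm) fun r => by
      apply e.injective
      simp only [AlgEquiv.trans_apply, ← hE, AlgEquiv.apply_symm_apply, hσ]
    refine ⟨c, ?_, fun h => ?_⟩
    · have := congrArg e hc
      simpa using this
    · ext s
      have := congrArg (fun d => e (d (e.symm s))) (hc0 h)
      simpa using this

theorem Rigid.of_trivial_isotropy [CharZero k]
    (himage : ∀ (r : R) (p : Polynomial k), (p.natDegree : ℕ∞) ≤ l → D r = Polynomial.aeval x p →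
      (∃ c : k, r = algebraMap k R c) ∧ p = 0)
    (htriv : ∀ σ : R ≃ₐ[k] R, (∀ f, σ (D f) = D (σ f)) → σ = AlgEquiv.refl) : Rigid l D x where
  image := himage
  nilp Δ hΔ hcomm := by
    have h := htriv (AlgEquiv.ofBijective (expHom hΔ) (expHom_bijective hΔ))
      (expHom_comm hΔ D hcomm)
    have h0 : Δ = 0 := eq_zero_of_expHom_eq_id hΔ fun r => congrArg (fun σ => σ r) h
    exact ⟨0, by simp [h0], fun _ => h0⟩
  isotropy σ hσ := ⟨0, by simp [htriv σ hσ], fun _ => htriv σ hσ⟩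

end Extension

section Tower

variable {k : Type*} [Field k]

/-- Splitting off the last variable of a polynomial ring. -/
noncomputable def lastVarEquiv (k : Type*) [Field k] (m : ℕ) :
    MvPolynomial (Fin (m + 1)) k ≃ₐ[k] Polynomial (MvPolynomial (Fin m) k) :=
  (renameEquiv k finSuccEquivLast).trans (optionEquivLeft k (Fin m))

theorem lastVarEquiv_last (m : ℕ) : lastVarEquiv k m (X (Fin.last m)) = Polynomial.X := by
  simp [lastVarEquiv]

theorem lastVarEquiv_rename (m : ℕ) (p : MvPolynomial (Fin m) k) :
    lastVarEquiv k m (rename Fin.castSucc p) = Polynomial.C p := by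
  have h : ((lastVarEquiv k m : _ →ₐ[k] _).comp (rename Fin.castSucc)) =
      (Polynomial.CAlgHom : MvPolynomial (Fin m) k →ₐ[k] _) := by
    ext1 j
    simp [lastVarEquiv]
  exact congrArg (fun φ => φ p) h

theorem derivation_rename {m n : ℕ} (φ : Fin m → Fin n)
    (d' : Derivation k (MvPolynomial (Fin m) k) (MvPolynomial (Fin m) k))
    (d : Derivation k (MvPolynomial (Fin n) k) (MvPolynomial (Fin n) k))
    (h : ∀ j, d (X (φ j)) = rename φ (d' (X j))) (p : MvPolynomial (Fin m) k) :
    d (rename φ p) = rename φ (d' p) := by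
  induction p using MvPolynomial.induction_on with
  | C a => simp
  | add p q hp hq => simp only [map_add, hp, hq]
  | mul_X p j hp => simp only [map_mul, Derivation.leibniz, rename_X, smul_eq_mul, map_add, hp, h]

variable {m : ℕ} {l : ℕ∞} {g : Polynomial k}
  {d' : Derivation k (MvPolynomial (Fin m) k) (MvPolynomial (Fin m) k)}
  {d : Derivation k (MvPolynomial (Fin (m + 1)) k) (MvPolynomial (Fin (m + 1)) k)}
  {x : MvPolynomial (Fin m) k}

theorem conj_lastVarEquiv
    (hd : ∀ j, d (X (Fin.castSucc j)) = rename Fin.castSucc (d' (X j)))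
    (hlast : d (X (Fin.last m)) = rename Fin.castSucc (Polynomial.aeval x g)) :
    (∀ r, conjDer (lastVarEquiv k m) d (Polynomial.C r) = Polynomial.C (d' r)) ∧
      conjDer (lastVarEquiv k m) d Polynomial.X = Polynomial.C (Polynomial.aeval x g) := by
  refine ⟨fun r => ?_, ?_⟩
  · rw [conjDer_apply, ← lastVarEquiv_rename, AlgEquiv.symm_apply_apply, derivation_rename _ d' d hd,
      lastVarEquiv_rename]
  · rw [conjDer_apply, ← lastVarEquiv_last, AlgEquiv.symm_apply_apply, hlast, lastVarEquiv_rename]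

theorem Rigid.add_variable [CharZero k] (hR : Rigid l d' x) (hg : 0 < g.natDegree)
    (hgl : (g.natDegree : ℕ∞) ≤ l)
    (hd : ∀ j, d (X (Fin.castSucc j)) = rename Fin.castSucc (d' (X j)))
    (hlast : d (X (Fin.last m)) = rename Fin.castSucc (Polynomial.aeval x g)) :
    Rigid ⊤ d (X (Fin.last m)) := by
  obtain ⟨hC, hX⟩ := conj_lastVarEquiv hd hlast
  have h := (hR.extension hg hgl hC hX).congr (lastVarEquiv k m).symm (E := d) fun r => by
    rw [conjDer_apply, AlgEquiv.symm_apply_apply]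
  rwa [← lastVarEquiv_last, AlgEquiv.symm_apply_apply] at h

theorem isotropy_add_variable [CharZero k] (hR : Rigid l d' x) (hg : 0 < g.natDegree)
    (hgl : (g.natDegree : ℕ∞) ≤ l)
    (hd : ∀ j, d (X (Fin.castSucc j)) = rename Fin.castSucc (d' (X j)))
    (hlast : d (X (Fin.last m)) = rename Fin.castSucc (Polynomial.aeval x g))
    (ρ : MvPolynomial (Fin (m + 1)) k ≃ₐ[k] MvPolynomial (Fin (m + 1)) k)
    (hρ : ∀ f, ρ (d f) = d (ρ f)) :
    (∀ j, ρ (X (Fin.castSucc j)) = X (Fin.castSucc j)) ∧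
      ∃ c : k, ρ (X (Fin.last m)) = X (Fin.last m) + C c := by
  obtain ⟨hC, hX⟩ := conj_lastVarEquiv hd hlast
  obtain ⟨h1, c, hc⟩ := isotropy_extension hR hg hgl hC hX
    (((lastVarEquiv k m).symm.trans ρ).trans (lastVarEquiv k m)) fun f => by
      simp [conjDer_apply, hρ]
  refine ⟨fun j => (lastVarEquiv k m).injective ?_, c, (lastVarEquiv k m).injective ?_⟩
  · have := h1 (X j)
    rw [← lastVarEquiv_rename, rename_X] at this
    simpa using this
  · rw [← lastVarEquiv_last] at hc
    rw [map_add, ← algebraMap_eq, AlgEquiv.commutes]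
    simpa using hc

/-- The derivation `d_i + g_i(x_i) ∂_{x_{i+1}} + ⋯ + g_{m-1}(x_{m-1}) ∂_{x_m}`. -/
noncomputable def towerDer {k : Type*} [Field k] {i : ℕ}
    (di : Derivation k (MvPolynomial (Fin i) k) (MvPolynomial (Fin i) k)) (G : ℕ → Polynomial k)
    (m : ℕ) (hm : i ≤ m) : Derivation k (MvPolynomial (Fin m) k) (MvPolynomial (Fin m) k) :=
  mkDerivation k fun j => if h : (j : ℕ) < i then rename (Fin.castLE hm) (di (X ⟨j, h⟩))
    else Polynomial.aeval (X (⟨j - 1, by omega⟩ : Fin m)) (G j)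

variable {i : ℕ} (di : Derivation k (MvPolynomial (Fin i) k) (MvPolynomial (Fin i) k))
  (G : ℕ → Polynomial k)

theorem towerDer_castSucc (hm : i ≤ m) (j : Fin m) :
    towerDer di G (m + 1) (hm.trans m.le_succ) (X (Fin.castSucc j)) =
      rename Fin.castSucc (towerDer di G m hm (X j)) := by
  simp only [towerDer, mkDerivation_X, Fin.val_castSucc]
  split_ifs with h
  · rw [rename_rename]
    rfl
  · rw [← Polynomial.aeval_algHom_apply, rename_X]
    rfl

theorem towerDer_last (hm : i ≤ m) (h0 : 0 < m) :
    towerDer di G (m + 1) (hm.trans m.le_succ) (X (Fin.last m)) =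
      rename Fin.castSucc (Polynomial.aeval (X (⟨m - 1, by omega⟩ : Fin m)) (G m)) := by
  simp only [towerDer, mkDerivation_X, Fin.val_last]
  rw [dif_neg (by omega), ← Polynomial.aeval_algHom_apply, rename_X]
  rfl

theorem towerDer_self : towerDer di G i le_rfl = di := by
  refine MvPolynomial.derivation_ext fun j => ?_
  simp [towerDer, Fin.castLE_rfl]

theorem exists_rigid_towerDer [CharZero k] (hi : 0 < i) (hR : Rigid l di (X (⟨i - 1, by omega⟩ : Fin i)))
    (hGl : ((G i).natDegree : ℕ∞) ≤ l) (hm : i ≤ m)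
    (hG : ∀ j, i ≤ j → j < m → 0 < (G j).natDegree) :
    ∃ l' : ℕ∞, Rigid l' (towerDer di G m hm) (X (⟨m - 1, by omega⟩ : Fin m)) ∧
      ((G m).natDegree : ℕ∞) ≤ l' := by
  induction m, hm using Nat.le_induction with
  | base => exact ⟨l, by rwa [towerDer_self], hGl⟩
  | succ m hm ih =>
    obtain ⟨l', hR', hl'⟩ := ih fun j h1 h2 => hG j h1 (by omega)
    exact ⟨⊤, hR'.add_variable (hG m hm (by omega)) hl' (towerDer_castSucc di G hm)
      (towerDer_last di G hm (by omega)), le_top⟩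

end Tower

/-- Main theorem: If `d_i` satisfies (i) the image condition relative to
`l`, (ii) some monomial-exponent matrix `A` of `d_i` satisfies condition (∗), and (iii)
the isotropy group of `d_i` is trivial, then the isotropy group of the extension
`d_n = d_i + g_i(x_i)∂_{x_{i+1}} + … + g_{n-1}(x_{n-1})∂_{x_n}` consists exactly of the
translations `(x₁,…,x_{n-1}, x_n + c)`, `c ∈ k`. (0-indexed variables.) -/
theorem stmt9 (k : Type*) [Field k] [CharZero k] (i n : ℕ) (hi : 2 ≤ i) (hin : i < n)
    (l : ℕ∞)
    (di : Derivation k (MvPolynomial (Fin i) k) (MvPolynomial (Fin i) k))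
    -- condition (i)
    (hdi : ∀ (r : MvPolynomial (Fin i) k) (g : Polynomial k),
      (g.natDegree : ℕ∞) ≤ l →
      di r = Polynomial.aeval (X (⟨i - 1, by omega⟩ : Fin i)) g →
      (∃ c : k, r = C c) ∧ g = 0)
    -- condition (ii): a matrix A_{d_i} built from top-degree monomials, satisfying (∗)
    (A : Matrix (Fin i) (Fin i) ℕ) (α : Fin i → k) (O : Fin i → MvPolynomial (Fin i) k)
    (hα : ∀ j, α j ≠ 0)
    (hA : ∀ j, di (X j) = C (α j) * (∏ q, X q ^ A j q) + O j)
    (hAdeg : ∀ j, (di (X j)).totalDegree = ∑ q, A j q)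
    (hstar : ∀ t : Fin i → ℕ, (∀ j, ∑ q, A j q * t q ≤ t j) → t = 0)
    -- condition (iii): trivial isotropy group of d_i
    (htriv : ∀ σ : MvPolynomial (Fin i) k ≃ₐ[k] MvPolynomial (Fin i) k,
      (∀ f, σ (di f) = di (σ f)) → σ = AlgEquiv.refl)
    -- the extension d_n
    (G : ℕ → Polynomial k)
    (hGnc : ∀ j : ℕ, i ≤ j → j < n → 0 < (G j).natDegree)
    (hGdeg : ((G i).natDegree : ℕ∞) ≤ l)
    (dn : Derivation k (MvPolynomial (Fin n) k) (MvPolynomial (Fin n) k))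
    (hres : ∀ j : Fin i,
      dn (X (Fin.castLE hin.le j)) = rename (Fin.castLE hin.le) (di (X j)))
    (hG : ∀ (j : ℕ) (h1 : i ≤ j) (h2 : j < n),
      dn (X (⟨j, h2⟩ : Fin n)) = Polynomial.aeval (X (⟨j - 1, by omega⟩ : Fin n)) (G j)) :
    ∀ ρ : MvPolynomial (Fin n) k ≃ₐ[k] MvPolynomial (Fin n) k,
      (∀ f, ρ (dn f) = dn (ρ f)) ↔
        ∃ c : k, (∀ j : Fin n, (j : ℕ) + 1 < n → ρ (X j) = X j) ∧
          ρ (X (⟨n - 1, by omega⟩ : Fin n)) = X (⟨n - 1, by omega⟩ : Fin n) + C c := by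
  obtain ⟨m, rfl⟩ : ∃ m, n = m + 1 := ⟨n - 1, by omega⟩
  have him : i ≤ m := by omega
  have hdn : dn = towerDer di G (m + 1) hin.le := by
    refine MvPolynomial.derivation_ext fun j => ?_
    rw [towerDer, mkDerivation_X]
    split_ifs with h
    · exact hres ⟨j, h⟩
    · exact hG j (by omega) j.2
  have hR : Rigid l di (X (⟨i - 1, by omega⟩ : Fin i)) := Rigid.of_trivial_isotropy hdi htriv
  obtain ⟨l', hR', hl'⟩ := exists_rigid_towerDer di G (by omega) hR hGdeg him
    fun j h1 h2 => hGnc j h1 (by omega)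
  intro ρ
  constructor
  · intro hρ
    subst hdn
    obtain ⟨h1, c, hc⟩ := isotropy_add_variable hR' (hGnc m him (by omega)) hl'
      (towerDer_castSucc di G him) (towerDer_last di G him (by omega)) ρ hρ
    exact ⟨c, fun j hj => h1 ⟨j, by omega⟩, hc⟩
  · rintro ⟨c, h1, hc⟩
    have hfix : ∀ p : MvPolynomial (Fin m) k,
        ρ (rename Fin.castSucc p) = rename Fin.castSucc p := fun p => by
      have h : (ρ : _ →ₐ[k] _).comp (rename Fin.castSucc) = rename (R := k) (Fin.castSucc (n := m)) := by
        ext1 j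
        simpa using h1 (Fin.castSucc j) (by simp)
      exact congrArg (fun φ => φ p) h
    have hfix' : ∀ j, ρ (dn (X j)) = dn (X j) := fun j => by
      subst hdn
      induction j using Fin.lastCases with
      | last => rw [towerDer_last di G him (by omega), hfix]
      | cast j => rw [towerDer_castSucc di G him, hfix]
    have hX : ∀ j, dn (ρ (X j)) = dn (X j) := fun j => by
      induction j using Fin.lastCases with
      | last =>
        have hc' : ρ (X (Fin.last m)) = X (Fin.last m) + C c := hc
        rw [hc', map_add, derivation_C, add_zero]
      | cast j => rw [h1 _ (by simp)]
    intro f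
    induction f using MvPolynomial.induction_on with
    | C a =>
      rw [← algebraMap_eq, dn.map_algebraMap, map_zero, AlgEquiv.commutes, dn.map_algebraMap]
    | add p q hp hq => simp only [map_add, hp, hq]
    | mul_X p j hp =>
      simp only [map_mul, Derivation.leibniz, smul_eq_mul, map_add, hp, hfix', hX]
end

section
/- Let k be a field of characteristic zero, m1, m2 positive integers with m2 ∤ m1, and let d₂ be the derivation of k[x₁,x₂] with d₂(x₁) = 1 + x₁^{m2} x₂ and d₂(x₂) = x₁^{m1}. Then for any n > 2 and any g_j ∈ k[x_j] \ k (2 ≤ j ≤ n-1), the derivation d_n = d₂ + g₂(x₂)∂_{x₃} + … + g_{n-1}(x_{n-1})∂_{x_n} of k[x₁,…,x_n] is simple and its isotropy group equals { (x₁, …, x_{n-1}, x_n + c) : c ∈ k }. -/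
section

open Polynomial

namespace Derivation

variable {k R : Type*} [CommRing k] [CommRing R] [Algebra k R]

/-- The derivation of `R[X]` killing `X` and acting on coefficients by `d`. -/
noncomputable def coeffwise (d : Derivation k R R) : Derivation k R[X] R[X] :=
  Derivation.mk'
    { toFun := fun f => PolynomialModule.equivPolynomialSelf (d.mapCoeffs f)
      map_add' := fun f g => by simp
      map_smul' := fun c f => by
        ext i
        change d ((c • f).coeff i) = (c • _ : R[X]).coeff i
        rw [coeff_smul, coeff_smul, d.map_smul]
        rfl }
    (fun f g => by
      ext i
      change d ((f * g).coeff i) = (f * _ + g * _ : R[X]).coeff i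
      rw [mul_comm g, coeff_add, coeff_mul, coeff_mul, coeff_mul, map_sum,
        ← Finset.sum_add_distrib]
      refine Finset.sum_congr rfl fun p _ => ?_
      rw [d.leibniz, smul_eq_mul, smul_eq_mul, mul_comm (g.coeff p.2)]
      rfl)

theorem coeff_coeffwise (d : Derivation k R R) (f : R[X]) (i : ℕ) :
    (d.coeffwise f).coeff i = d (f.coeff i) := rfl

theorem coeffwise_C (d : Derivation k R R) (a : R) : d.coeffwise (C a) = C (d a) := by
  ext i
  rw [coeff_coeffwise, coeff_C, coeff_C]
  split_ifs <;> simp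

theorem coeffwise_X (d : Derivation k R R) : d.coeffwise (X : R[X]) = 0 := by
  ext i
  rw [coeff_coeffwise, coeff_X]
  split_ifs <;> simp

/-- The derivation of `R[X]` extending `d` and sending `X` to `g`. -/
noncomputable def extend (d : Derivation k R R) (g : R[X]) : Derivation k R[X] R[X] :=
  d.coeffwise + g • (derivative' : Derivation R R[X] R[X]).restrictScalars k

theorem extend_apply (d : Derivation k R R) (g f : R[X]) :
    d.extend g f = d.coeffwise f + g * derivative f := rfl

theorem polynomial_ext_C_X {M : Type*} [AddCommGroup M] [Module k M] [Module R[X] M]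
    {D₁ D₂ : Derivation k R[X] M} (hC : ∀ a, D₁ (C a) = D₂ (C a)) (hX : D₁ X = D₂ X) :
    D₁ = D₂ := by
  ext f
  induction f using Polynomial.induction_on' with
  | add p q hp hq => rw [map_add, map_add, hp, hq]
  | monomial n a =>
    rw [← C_mul_X_pow_eq_monomial, D₁.leibniz, D₂.leibniz, D₁.leibniz_pow, D₂.leibniz_pow, hC, hX]

theorem coeff_eq_of_C_X {D : Derivation k R[X] R[X]} {d : Derivation k R R} {g : R}
    (hC : ∀ a, D (C a) = C (d a)) (hX : D X = C g) (f : R[X]) (i : ℕ) :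
    (D f).coeff i = d (f.coeff i) + (i + 1) * g * f.coeff (i + 1) := by
  have : D = d.extend (C g) := polynomial_ext_C_X
    (fun a => by rw [hC, extend_apply, coeffwise_C, derivative_C, mul_zero, add_zero])
    (by rw [hX, extend_apply, coeffwise_X, derivative_X, mul_one, zero_add])
  rw [this, extend_apply, coeff_add, coeff_coeffwise, coeff_C_mul, coeff_derivative]
  ring

/-- A derivation is simple if its only stable ideals are the trivial ones. -/
def IsSimple (d : Derivation k R R) : Prop :=
  ∀ I : Ideal R, (∀ f ∈ I, d f ∈ I) → I = ⊥ ∨ I = ⊤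

/-- Powers of `d f` lie in a `d`-stable ideal containing a power of `f`. -/
theorem pow_apply_mem_of_pow_mem [Algebra ℚ R] (d : Derivation k R R) {I : Ideal R}
    (hI : ∀ f ∈ I, d f ∈ I) {f : R} {r : ℕ} (h : f ^ r ∈ I) : d f ^ (2 * r) ∈ I := by
  suffices H : ∀ i j, f ^ i * d f ^ j ∈ I → d f ^ (j + 2 * i) ∈ I by
    simpa using H r 0 (by simpa using h)
  intro i
  induction i with
  | zero => intro j hj; simpa using hj
  | succ i ih =>
    intro j hj
    rw [show j + 2 * (i + 1) = (j + 2) + 2 * i by ring]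
    apply ih
    have h1 := I.mul_mem_left (d f) (hI _ hj)
    have h2 : ((i : R) + 1) * (f ^ i * d f ^ (j + 2)) =
        d f * d (f ^ (i + 1) * d f ^ j) - j * d (d f) * (f ^ (i + 1) * d f ^ j) := by
      rw [d.leibniz, d.leibniz_pow, d.leibniz_pow]
      simp only [smul_eq_mul, nsmul_eq_mul, Nat.add_sub_cancel]
      rcases j with _ | j
      · simp; ring
      · simp only [Nat.add_sub_cancel]; push_cast; ring
    have h3 : ((i : R) + 1) * (f ^ i * d f ^ (j + 2)) ∈ I := by
      rw [h2]; exact I.sub_mem h1 (I.mul_mem_left _ hj)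
    have h4 : algebraMap ℚ R ((i + 1 : ℚ)⁻¹) * ((i : R) + 1) = 1 := by
      have : ((i : R) + 1) = algebraMap ℚ R (i + 1) := by simp
      rw [this, ← map_mul, inv_mul_cancel₀ (by positivity), map_one]
    have := I.mul_mem_left (algebraMap ℚ R ((i + 1 : ℚ)⁻¹)) h3
    rwa [← mul_assoc, h4, one_mul] at this

end Derivation

section Extension

variable {k R : Type*} [Field k] [CharZero k] [CommRing R] [Algebra k R]
  {d : Derivation k R R} {D : Derivation k R[X] R[X]} {g : R}

namespace Derivation

omit [CharZero k] in
theorem natDegree_apply_le (hC : ∀ a, D (C a) = C (d a)) (hX : D X = C g) (f : R[X]) :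
    (D f).natDegree ≤ f.natDegree := by
  rw [natDegree_le_iff_coeff_eq_zero]
  intro i hi
  rw [coeff_eq_of_C_X hC hX, coeff_eq_zero_of_natDegree_lt hi,
    coeff_eq_zero_of_natDegree_lt (hi.trans i.lt_succ_self)]
  simp

theorem IsSimple.of_C_X (hd : d.IsSimple) (hC : ∀ a, D (C a) = C (d a)) (hX : D X = C g)
    (hg : ∀ r, d r ≠ g) : D.IsSimple := by
  classical
  intro I hI
  by_contra! H
  obtain ⟨hbot, htop⟩ := H
  have hex : ∃ n, ∃ f ∈ I, f ≠ 0 ∧ f.natDegree = n := by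
    obtain ⟨f, hf, hf0⟩ := Submodule.exists_mem_ne_zero_of_ne_bot hbot
    exact ⟨_, f, hf, hf0, rfl⟩
  obtain ⟨f₀, hf₀, hf₀0, hN⟩ := Nat.find_spec hex
  have hmin : ∀ f ∈ I, f ≠ 0 → Nat.find hex ≤ f.natDegree :=
    fun f hf hf0 => Nat.find_min' hex ⟨f, hf, hf0, rfl⟩
  generalize Nat.find hex = N at hN hmin
  let J : Ideal R :=
    { carrier := {a | ∃ f ∈ I, f.natDegree ≤ N ∧ f.coeff N = a}
      add_mem' := by
        rintro _ _ ⟨f, hf, hfN, rfl⟩ ⟨f', hf', hfN', rfl⟩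
        exact ⟨f + f', I.add_mem hf hf', natDegree_add_le_of_degree_le hfN hfN', coeff_add _ _ _⟩
      zero_mem' := ⟨0, I.zero_mem, by simp, by simp⟩
      smul_mem' := by
        rintro a _ ⟨f, hf, hfN, rfl⟩
        exact ⟨C a * f, I.mul_mem_left _ hf, (natDegree_C_mul_le _ _).trans hfN, coeff_C_mul _⟩ }
  have hJ : ∀ a ∈ J, d a ∈ J := by
    rintro _ ⟨f, hf, hfN, rfl⟩
    refine ⟨D f, hI f hf, (natDegree_apply_le hC hX f).trans hfN, ?_⟩
    rw [coeff_eq_of_C_X hC hX, coeff_eq_zero_of_natDegree_lt (Nat.lt_succ_of_le hfN)]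
    simp
  rcases hd J hJ with h | h
  · have : f₀.coeff N ∈ J := ⟨f₀, hf₀, hN.le, rfl⟩
    rw [h, Ideal.mem_bot, ← hN] at this
    exact hf₀0 (leadingCoeff_eq_zero.mp this)
  · obtain ⟨f, hf, hfN, hf1⟩ : (1 : R) ∈ J := h ▸ Submodule.mem_top
    have hDf : D f = 0 := by
      by_contra h0
      have h1 := (natDegree_apply_le hC hX f).trans hfN
      have h2 := h1.antisymm (hmin _ (hI f hf) h0)
      apply h0
      rw [← leadingCoeff_eq_zero, leadingCoeff, h2, coeff_eq_of_C_X hC hX,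
        coeff_eq_zero_of_natDegree_lt (Nat.lt_succ_of_le hfN), hf1]
      simp
    rcases N with _ | M
    · apply htop
      rw [eq_C_of_natDegree_le_zero hfN, hf1] at hf
      exact (Ideal.eq_top_iff_one I).mpr (by simpa using hf)
    · have h1 := coeff_eq_of_C_X hC hX f M
      rw [hDf, hf1, coeff_zero] at h1
      apply hg (-((M + 1 : k)⁻¹ • f.coeff M))
      have h2 : d (f.coeff M) = -((M + 1 : k) • g) := by
        rw [Algebra.smul_def, show algebraMap k R (M + 1 : k) = M + 1 by simp]
        linear_combination -h1
      rw [map_neg, d.map_smul, h2, smul_neg, neg_neg, smul_smul, inv_mul_cancel₀, one_smul]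
      exact Nat.cast_add_one_ne_zero M

section Tower

variable {t : R} {p : k[X]}

/-- An element with derivative a polynomial in `t` is a scalar. -/
def OnlyScalarPrimitives (d : Derivation k R R) (t : R) : Prop :=
  ∀ (a : R) (q : k[X]), d a = aeval t q → ∃ c, a = algebraMap k R c

omit [CharZero k] in
theorem OnlyScalarPrimitives.eq_zero_of_add (hd : d.OnlyScalarPrimitives t)
    (ht : Transcendental k t) (hp : 0 < p.natDegree) {a : R} {α γ : k}
    (h : d a + algebraMap k R α * aeval t p = algebraMap k R γ) :
    α = 0 ∧ ∃ c, a = algebraMap k R c := by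
  have ha : ∃ c, a = algebraMap k R c := by
    apply hd a (C γ - C α * p)
    rw [map_sub, map_mul, aeval_C, aeval_C, ← h]
    ring
  refine ⟨?_, ha⟩
  obtain ⟨c, rfl⟩ := ha
  rw [d.map_algebraMap, zero_add] at h
  have h1 : C α * p - C γ = 0 := by
    by_contra h0
    exact ht ⟨_, h0, by rw [map_sub, map_mul, aeval_C, aeval_C, h, sub_self]⟩
  have h2 := congrArg (coeff · p.natDegree) h1
  simp only [coeff_sub, coeff_C_mul, coeff_C, hp.ne', if_false, sub_zero, coeff_zero,
    coeff_natDegree, mul_eq_zero, leadingCoeff_eq_zero] at h2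
  exact h2.resolve_right fun h => by simp [h] at hp

/-- If all higher coefficients of `D f` are scalars, then `f` is affine with scalar slope. -/
theorem OnlyScalarPrimitives.eq_C_add (hd : d.OnlyScalarPrimitives t)
    (ht : Transcendental k t) (hp : 0 < p.natDegree)
    (hC : ∀ a, D (C a) = C (d a)) (hX : D X = C (aeval t p)) {f : R[X]}
    (h : ∀ i, ∃ c, (D f).coeff (i + 1) = algebraMap k R c) :
    ∃ a α, f = C a + C (algebraMap k R α) * X := by
  have key : f.natDegree ≤ 1 ∧ ∃ c, f.coeff 1 = algebraMap k R c := by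
    rcases hN : f.natDegree with _ | N
    · exact ⟨zero_le_one, 0, by
        rw [map_zero, coeff_eq_zero_of_natDegree_lt (by omega)]⟩
    obtain ⟨α, hα⟩ : ∃ c, f.coeff (N + 1) = algebraMap k R c := by
      obtain ⟨γ, hγ⟩ := h N
      rw [coeff_eq_of_C_X hC hX, coeff_eq_zero_of_natDegree_lt (p := f) (n := N + 1 + 1) (by omega),
        mul_zero, add_zero] at hγ
      exact hd _ (C γ) (by rw [hγ, aeval_C])
    rcases N with _ | N
    · exact ⟨le_rfl, α, hα⟩
    · exfalso
      obtain ⟨γ, hγ⟩ := h N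
      rw [coeff_eq_of_C_X hC hX, hα] at hγ
      have h1 := (hd.eq_zero_of_add ht hp (a := f.coeff (N + 1))
        (α := ((N + 2 : ℕ) : k) * α) (γ := γ) (by
        rw [← hγ, map_mul, _root_.map_natCast]
        push_cast; ring)).1
      have h2 : α = 0 := (mul_eq_zero.mp h1).resolve_left (Nat.cast_ne_zero.mpr (by omega))
      rw [h2, map_zero, ← hN, coeff_natDegree, leadingCoeff_eq_zero] at hα
      simp [hα] at hN
  obtain ⟨h1, α, hα⟩ := key
  refine ⟨f.coeff 0, α, ?_⟩
  rw [← hα, add_comm]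
  exact eq_X_add_C_of_natDegree_le_one h1

theorem OnlyScalarPrimitives.of_C_X (hd : d.OnlyScalarPrimitives t)
    (ht : Transcendental k t) (hp : 0 < p.natDegree)
    (hC : ∀ a, D (C a) = C (d a)) (hX : D X = C (aeval t p)) :
    D.OnlyScalarPrimitives X := by
  intro f q hf
  have hco : ∀ i, (D f).coeff i = algebraMap k R (q.coeff i) := by
    intro i
    rw [hf, show aeval (X : R[X]) q = q.map (algebraMap k R) by
      rw [aeval_def, eval₂_eq_sum_range, map, eval₂_eq_sum_range]
      rfl, coeff_map]
  obtain ⟨a, α, rfl⟩ := hd.eq_C_add ht hp hC hX fun i => ⟨_, hco (i + 1)⟩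
  have h0 := hco 0
  rw [coeff_eq_of_C_X hC hX] at h0
  obtain ⟨rfl, c, rfl⟩ := hd.eq_zero_of_add ht hp (a := a) (α := α) (γ := q.coeff 0) (by
    rw [← h0]; simp; ring)
  exact ⟨c, by simp [← Polynomial.algebraMap_apply]⟩

omit [CharZero k] in
theorem exists_eq_C_of_orbit [IsDomain R] (hC : ∀ a, D (C a) = C (d a)) (hX : D X = C g) {l m : ℕ}
    (hl : 0 < l) (hm : 0 < m) {u w : R[X]} (hu : D u = 1 + u ^ m * w) (hw : D w = u ^ l) :
    ∃ a b, u = C a ∧ w = C b := by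
  have hu0 : u ≠ 0 := by
    rintro rfl
    simp [hm.ne'] at hu
  have hw0 : w ≠ 0 := by
    rintro rfl
    rw [map_zero] at hw
    exact hu0 (pow_eq_zero_iff hl.ne' |>.mp hw.symm)
  have h1 : m * u.natDegree + w.natDegree ≤ u.natDegree := by
    rw [← natDegree_pow, ← natDegree_mul (pow_ne_zero _ hu0) hw0,
      show u ^ m * w = D u - 1 by rw [hu]; ring]
    exact (natDegree_sub_le _ _).trans
      (max_le (natDegree_apply_le hC hX u) (by simp))
  have h2 : l * u.natDegree ≤ w.natDegree := by
    rw [← natDegree_pow, ← hw]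
    exact natDegree_apply_le hC hX w
  have h3 : u.natDegree ≤ l * u.natDegree := Nat.le_mul_of_pos_left _ hl
  have h4 : u.natDegree ≤ m * u.natDegree := Nat.le_mul_of_pos_left _ hm
  exact ⟨_, _, eq_C_of_natDegree_le_zero (by omega), eq_C_of_natDegree_le_zero (by omega)⟩

end Tower

end Derivation

end Extension

section Planar

variable {k : Type*} [Field k] [CharZero k] {l m : ℕ}
  {δ : Derivation k k[X][X] k[X][X]}

namespace Derivation

omit [CharZero k] in
theorem planar_apply (hx : δ (C X) = 1 + C X ^ m * X) (hy : δ X = C X ^ l) (F : k[X][X]) :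
    δ F = (1 + C X ^ m * X) * (derivative' : Derivation k k[X] k[X]).coeffwise F +
      C X ^ l * derivative F := by
  have : δ = (1 + C X ^ m * X : k[X][X]) • (derivative' : Derivation k k[X] k[X]).coeffwise +
      (C X ^ l : k[X][X]) •
        (derivative' : Derivation k[X] k[X][X] k[X][X]).restrictScalars k := by
    refine polynomial_ext_C_X (fun a => ?_) ?_
    · have h1 : (C a : k[X][X]) = aeval (C X) a := by
        rw [← algebraMap_eq (R := k[X]), aeval_algebraMap_apply, aeval_X_left_apply]
      have h2 : δ (C a) = C (derivative a) * δ (C X) := by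
        conv_lhs => rw [h1, δ.map_aeval]
        rw [← algebraMap_eq (R := k[X]), aeval_algebraMap_apply, aeval_X_left_apply, smul_eq_mul]
      rw [h2, hx]
      change _ = _ * (derivative' : Derivation k k[X] k[X]).coeffwise (C a) +
        _ * derivative (C a)
      rw [coeffwise_C, derivative_C, mul_zero, add_zero, mul_comm]
      rfl
    · rw [hy]
      change _ = _ * (derivative' : Derivation k k[X] k[X]).coeffwise X +
        (C X ^ l : k[X][X]) * derivative X
      rw [coeffwise_X, derivative_X, mul_zero, zero_add, mul_one]
  rw [this]
  rfl

omit [CharZero k] in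
theorem coeff_zero_planar (hx : δ (C X) = 1 + C X ^ m * X) (hy : δ X = C X ^ l) (F : k[X][X]) :
    (δ F).coeff 0 = derivative (F.coeff 0) + X ^ l * F.coeff 1 := by
  rw [planar_apply hx hy, add_mul, mul_assoc, ← C_pow, ← C_pow, coeff_add, coeff_add,
    coeff_C_mul, coeff_C_mul, one_mul, mul_coeff_zero, coeff_X_zero, coeff_derivative,
    coeff_coeffwise]
  simp

omit [CharZero k] in
theorem coeff_succ_planar (hx : δ (C X) = 1 + C X ^ m * X) (hy : δ X = C X ^ l) (F : k[X][X])
    (i : ℕ) : (δ F).coeff (i + 1) = derivative (F.coeff (i + 1)) + X ^ m * derivative (F.coeff i) +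
      ((i : k[X]) + 2) * (X ^ l * F.coeff (i + 2)) := by
  rw [planar_apply hx hy, add_mul, mul_assoc, ← C_pow, ← C_pow]
  simp only [one_mul, coeff_add, coeff_C_mul, coeff_X_mul, coeff_derivative, coeff_coeffwise]
  simp only [derivative'_apply, Nat.cast_add, Nat.cast_one]
  ring

omit [CharZero k] in
theorem natDegree_planar_le (hx : δ (C X) = 1 + C X ^ m * X) (hy : δ X = C X ^ l)
    (F : k[X][X]) : (δ F).natDegree ≤ F.natDegree + 1 := by
  rw [natDegree_le_iff_coeff_eq_zero]
  rintro (_ | i) hi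
  · omega
  · rw [coeff_succ_planar hx hy, coeff_eq_zero_of_natDegree_lt (by omega : _ < i + 1),
      coeff_eq_zero_of_natDegree_lt (by omega : _ < i),
      coeff_eq_zero_of_natDegree_lt (by omega : _ < i + 2)]
    simp

omit [CharZero k] in
theorem _root_.Polynomial.eq_zero_of_X_pow_mul_eq_C (hm : 0 < m) {b : k[X]} {γ : k}
    (h : X ^ m * b = C γ) : b = 0 := by
  ext n
  have := congrArg (coeff · (n + m)) h
  simpa [coeff_X_pow_mul, coeff_C, hm.ne'] using this

theorem onlyScalarPrimitives_planar (hm : 0 < m) (hlm : ¬ m ∣ l)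
    (hx : δ (C X) = 1 + C X ^ m * X) (hy : δ X = C X ^ l) : δ.OnlyScalarPrimitives X := by
  intro F q hF
  have hco : ∀ i, (δ F).coeff i = C (q.coeff i) := by
    intro i
    rw [hF, show aeval (X : k[X][X]) q = q.map (algebraMap k k[X]) by
      rw [aeval_def, eval₂_eq_sum_range, map, eval₂_eq_sum_range]
      rfl, coeff_map]
    rfl
  have h0 := coeff_zero_planar hx hy F
  have hs := coeff_succ_planar hx hy F
  simp only [hco] at h0 hs
  have hz : ∀ {n}, F.natDegree < n → F.coeff n = 0 := coeff_eq_zero_of_natDegree_lt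
  rcases hN : F.natDegree with _ | M
  · have h1 := hs 0
    rw [hz (by omega : _ < 0 + 1), hz (by omega : _ < 0 + 2)] at h1
    simp only [map_zero, mul_zero, add_zero, zero_add] at h1
    have h2 := derivative_eq_zero.mp (eq_zero_of_X_pow_mul_eq_C hm h1.symm)
    refine ⟨(F.coeff 0).coeff 0, (eq_C_of_natDegree_le_zero hN.le).trans ?_⟩
    exact congrArg C (eq_C_of_natDegree_le_zero h2.le)
  · exfalso
    have hr : ∀ i p, p ≤ l → m ∣ l - p →
        (derivative (F.coeff i)).coeff p + (i + 1) * (X ^ l * F.coeff (i + 1)).coeff p = 0 := by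
      intro i
      induction i with
      | zero =>
        intro p hp hd
        have hp0 : p ≠ 0 := by rintro rfl; exact hlm (by simpa using hd)
        have := congrArg (coeff · p) h0
        simp only [coeff_C, hp0, if_false, coeff_add] at this
        rw [this]; simp
      | succ i ih =>
        intro p hp hd
        have hp0 : p ≠ 0 := by rintro rfl; exact hlm (by simpa using hd)
        have h1 := congrArg (coeff · p) (hs i)
        rw [show ((i : k[X]) + 2) = C (i + 2 : k) by simp; exact (_root_.map_ofNat C 2).symm] at h1
        simp only [coeff_C, hp0, if_false, coeff_add, coeff_C_mul] at h1
        have h2 : (X ^ m * derivative (F.coeff i)).coeff p = 0 := by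
          rw [coeff_X_pow_mul']
          split_ifs with hmp
          · have h3 := ih (p - m) (by omega) (by
              rw [show l - (p - m) = l - p + m by omega]
              exact (Nat.dvd_add_right hd).mpr dvd_rfl)
            rwa [coeff_X_pow_mul', if_neg (by omega), mul_zero, add_zero] at h3
          · rfl
        rw [h2] at h1
        rw [h1]; push_cast; ring
    have h1 := hs (M + 1)
    rw [hz (by omega : _ < M + 1 + 1), hz (by omega : _ < M + 1 + 2)] at h1
    simp only [map_zero, mul_zero, add_zero, zero_add] at h1
    have h2 := eq_zero_of_X_pow_mul_eq_C hm h1.symm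
    have h3 := eq_C_of_natDegree_le_zero (derivative_eq_zero.mp h2).le
    have h4 := hs M
    rw [h2, hz (by omega : _ < M + 2), mul_zero, mul_zero, add_zero, zero_add] at h4
    have h5 := eq_zero_of_X_pow_mul_eq_C hm h4.symm
    have h6 := hr M l le_rfl (by simp)
    rw [h5, h3, coeff_zero, zero_add, coeff_X_pow_mul', if_pos le_rfl, Nat.sub_self,
      coeff_C_zero, mul_eq_zero] at h6
    rw [h6.resolve_left (Nat.cast_add_one_ne_zero M), C_0] at h3
    have h7 : F.leadingCoeff = 0 := by rw [leadingCoeff, hN, h3]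
    rw [leadingCoeff_eq_zero.mp h7] at hN
    simp at hN

/-- The derivation `x δ` in the coordinates `T = x` and `v = 1 + x ^ m y`, where `T` is the outer
variable. -/
noncomputable def blowup (l m : ℕ) (G : k[X][X]) : k[X][X] :=
  C X * X * derivative G + (C (C (m : k) * ((X - 1) * X)) + X ^ (l + m + 1)) *
    (derivative' : Derivation k k[X] k[X]).coeffwise G

omit [CharZero k] in
theorem coeff_blowup (G : k[X][X]) (w : ℕ) :
    (blowup l m G).coeff w = C (w : k) * (X * G.coeff w) +
      C (m : k) * ((X - 1) * (X * derivative (G.coeff w))) +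
      if l + m + 1 ≤ w then derivative (G.coeff (w - (l + m + 1))) else 0 := by
  have h1 : (C X * X * derivative G : k[X][X]).coeff w = C (w : k) * (X * G.coeff w) := by
    rw [mul_assoc, coeff_C_mul]
    rcases w with _ | w
    · simp
    · rw [coeff_X_mul, coeff_derivative]; simp; ring
  rw [blowup, coeff_add, h1, add_mul, coeff_add, coeff_C_mul, coeff_X_pow_mul']
  simp only [coeff_coeffwise, derivative'_apply]
  ring

/-- The part of the eigenvalue equation of `blowup` acting on the coefficient of `T ^ w`. -/
noncomputable def blowupOp (m : ℕ) (B e c : k) (h : k[X]) : k[X] :=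
  C c * (X * h) + C (m : k) * ((X - 1) * (X * derivative h)) - (C B * X + C e * (X - 1)) * h

omit [CharZero k] in
theorem _root_.Polynomial.coeff_X_mul_derivative (h : k[X]) (t : ℕ) :
    (X * derivative h).coeff t = t * h.coeff t := by
  rcases t with _ | t
  · simp
  · rw [coeff_X_mul, coeff_derivative]; push_cast; ring

omit [CharZero k] in
theorem blowupOp_eq (B e c : k) (h : k[X]) : blowupOp m B e c h =
    C (c - B - e) * (X * h) + C e * h + C (m : k) * (X * (X * derivative h)) -
      C (m : k) * (X * derivative h) := by
  rw [blowupOp, C_sub, C_sub]; ring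

omit [CharZero k] in
theorem coeff_zero_blowupOp (B e c : k) (h : k[X]) :
    (blowupOp m B e c h).coeff 0 = e * h.coeff 0 := by
  rw [blowupOp_eq]; simp

omit [CharZero k] in
theorem coeff_succ_blowupOp (B e c : k) (h : k[X]) (t : ℕ) :
    (blowupOp m B e c h).coeff (t + 1) =
      (c - B - e + m * t) * h.coeff t + (e - m * (t + 1)) * h.coeff (t + 1) := by
  rw [blowupOp_eq]
  simp only [coeff_sub, coeff_add, coeff_C_mul, coeff_X_mul, coeff_X_mul_derivative]
  rw [coeff_derivative]
  ring

theorem coeff_eq_zero_of_blowupOp (hm : 0 < m) {B c : k} {s n : ℕ} (hn : n ≤ s) {h : k[X]}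
    (H : ∀ t < n, (blowupOp m B (m * s) c h).coeff t = 0) : ∀ t < n, h.coeff t = 0 := by
  have hm' : (m : k) ≠ 0 := Nat.cast_ne_zero.mpr hm.ne'
  intro t
  induction t with
  | zero =>
    intro ht
    have h1 := H 0 ht
    rw [coeff_zero_blowupOp] at h1
    have hs' : (s : k) ≠ 0 := Nat.cast_ne_zero.mpr (by omega)
    simpa [hm', hs'] using h1
  | succ t ih =>
    intro ht
    have h1 := H (t + 1) ht
    rw [coeff_succ_blowupOp, ih (by omega), mul_zero, zero_add, mul_eq_zero] at h1
    refine h1.resolve_left fun h2 => ?_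
    have h3 : (m : k) * ((s : k) - ((t + 1 : ℕ) : k)) = 0 := by push_cast; linear_combination h2
    rw [mul_eq_zero, sub_eq_zero, Nat.cast_inj] at h3
    rcases h3 with h3 | h3
    · exact hm' h3
    · omega

theorem coeff_blowupOp_eq_zero (hm : 0 < m) {B c : k} {s : ℕ} {h : k[X]}
    (H : ∀ t < s, (blowupOp m B (m * s) c h).coeff t = 0) :
    (blowupOp m B (m * s) c h).coeff s = 0 := by
  have h1 := coeff_eq_zero_of_blowupOp hm le_rfl H
  rcases s with _ | s
  · rw [coeff_zero_blowupOp]; simp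
  · rw [coeff_succ_blowupOp, h1 s (by omega)]; push_cast; ring

theorem eigenvalue_blowup_eq_zero (hm : 0 < m) {G : k[X][X]} (hG : G.coeff 0 ≠ 0)
    {B e : k} {K : k[X]}
    (h : blowup l m G = (C (C B * X + C e * (X - 1)) + X * K.map C) * G) : e = 0 ∧ K = 0 := by
  have hm' : (m : k) ≠ 0 := Nat.cast_ne_zero.mpr hm.ne'
  have hop : ∀ w : ℕ, blowupOp m B e w (G.coeff w) +
      (if l + m + 1 ≤ w then derivative (G.coeff (w - (l + m + 1))) else 0) =
      (X * (K.map C * G)).coeff w := by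
    intro w
    have h1 := congrArg (coeff · w) h
    simp only [coeff_blowup] at h1
    rw [add_mul, coeff_add, coeff_C_mul, mul_assoc] at h1
    rw [blowupOp]
    linear_combination h1
  set g := G.coeff 0 with hg
  have hg0 : blowupOp m B e 0 g = 0 := by simpa using hop 0
  set s := g.natTrailingDegree with hs
  have hgs : g.coeff s ≠ 0 := by rwa [hs, ← trailingCoeff, Ne, trailingCoeff_eq_zero]
  have hglt : ∀ t < s, g.coeff t = 0 := fun t ht => coeff_eq_zero_of_lt_natTrailingDegree ht
  have he : e = m * s := by
    have h1 := congrArg (coeff · s) hg0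
    rcases hs' : s with _ | t
    · simp only [hs', coeff_zero_blowupOp, coeff_zero] at h1
      rw [hs'] at hgs
      simpa [hgs] using h1
    · simp only [hs', coeff_succ_blowupOp, coeff_zero, hglt t (by omega), mul_zero, zero_add] at h1
      rw [hs'] at hgs
      push_cast
      linear_combination (mul_eq_zero.mp h1).resolve_right hgs
  have hdeg : ∀ n, g.natDegree = n → B = m * (n - s) := by
    intro n hn
    have h1 := congrArg (coeff · (n + 1)) hg0
    simp only [coeff_succ_blowupOp, coeff_zero] at h1
    rw [coeff_eq_zero_of_natDegree_lt (by omega : g.natDegree < n + 1), mul_zero, add_zero,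
      ← hn, coeff_natDegree, mul_eq_zero, or_iff_left (leadingCoeff_ne_zero.mpr hG), he, hn] at h1
    linear_combination -h1
  have hK : K = 0 := by
    by_contra hK
    have hq : ∀ i, i + 1 < l + m + 1 → K.coeff i = 0 := by
      intro i
      induction i using Nat.strong_induction_on with
      | _ i ih =>
        intro hi
        have h1 := hop (i + 1)
        rw [if_neg (by omega), add_zero, coeff_X_mul, coeff_mul,
          Finset.sum_eq_single (i, 0) (fun p hp hne => by
            have := Finset.HasAntidiagonal.mem_antidiagonal.mp hp
            rw [coeff_map, ih p.1 (by
              rcases p with ⟨a, b⟩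
              simp only [ne_eq, Prod.mk.injEq] at hne this ⊢
              omega) (by omega), C_0, zero_mul]) (fun h => by simp at h), coeff_map, ← hg, he] at h1
        have h2 := coeff_blowupOp_eq_zero (B := B) (c := ((i + 1 : ℕ) : k)) (s := s)
          (h := G.coeff (i + 1)) hm (fun t ht => by rw [h1, coeff_C_mul, hglt t ht, mul_zero])
        rw [h1, coeff_C_mul, mul_eq_zero] at h2
        exact h2.resolve_right hgs
    have hG0 : G ≠ 0 := by rintro rfl; exact hG (by simp [hg])
    have hκ : l + m ≤ K.natDegree := by
      by_contra! hlt
      exact hK (leadingCoeff_eq_zero.mp (hq _ (by omega)))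
    have h1 := hop (G.natDegree + K.natDegree + 1)
    have h2 : (K.map C * G).coeff (G.natDegree + K.natDegree) =
        C K.leadingCoeff * G.leadingCoeff := by
      have hn : (K.map (C : k →+* k[X])).natDegree = K.natDegree :=
        natDegree_map_eq_of_injective C_injective K
      rw [add_comm, ← hn, coeff_mul_degree_add_degree, leadingCoeff_map_of_injective C_injective]
    rw [coeff_X_mul, h2, coeff_eq_zero_of_natDegree_lt (by omega : G.natDegree < _),
      if_pos (by omega), show blowupOp m B e _ 0 = 0 by simp [blowupOp], zero_add] at h1
    have hl0 : G.leadingCoeff ≠ 0 := leadingCoeff_ne_zero.mpr hG0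
    have hK0 : K.leadingCoeff ≠ 0 := leadingCoeff_ne_zero.mpr hK
    have hne : C K.leadingCoeff * G.leadingCoeff ≠ 0 := mul_ne_zero (C_ne_zero.mpr hK0) hl0
    rcases hκ.eq_or_lt with hκ | hκ
    · rw [show G.natDegree + K.natDegree + 1 - (l + m + 1) = G.natDegree by omega,
        coeff_natDegree] at h1
      have h3 := degree_derivative_lt hl0
      rw [h1, degree_C_mul hK0] at h3
      exact lt_irrefl _ h3
    · rw [coeff_eq_zero_of_natDegree_lt (by omega), derivative_zero] at h1
      exact hne h1.symm
  refine ⟨?_, hK⟩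
  have hL := hop (l + m + 1)
  rw [if_pos le_rfl, Nat.sub_self, ← hg, hK, Polynomial.map_zero, zero_mul, mul_zero, coeff_zero,
    he] at hL
  set h' := G.coeff (l + m + 1)
  have hL' : ∀ t, (blowupOp m B (m * s) ((l + m + 1 : ℕ) : k) h').coeff t =
      - (g.coeff (t + 1) * (t + 1)) := fun t => by
    have := congrArg (coeff · t) hL
    simp only [coeff_add, coeff_derivative, coeff_zero] at this
    linear_combination this
  rcases hs' : s with _ | t
  · rw [he, hs']; simp
  exfalso
  have hz := coeff_eq_zero_of_blowupOp (B := B) (c := ((l + m + 1 : ℕ) : k)) (s := s) (n := t)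
    (h := h') hm (by omega) (fun i hi => by rw [hL', hglt _ (by omega)]; simp)
  have e1 : (m : k) * h'.coeff t = - (g.coeff (t + 1) * (t + 1)) := by
    rw [← hL' t]
    rcases t with _ | t
    · rw [coeff_zero_blowupOp, hs']; simp
    · rw [coeff_succ_blowupOp, hz t (by omega), hs']; push_cast; ring
  have e2 := hL' (t + 1)
  rw [coeff_succ_blowupOp, hs'] at e2
  have e3 := congrArg (coeff · (t + 2)) hg0
  simp only [coeff_succ_blowupOp, coeff_zero, he, hs'] at e3
  have hn : t + 1 ≤ g.natDegree := hs' ▸ natTrailingDegree_le_natDegree g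
  obtain ⟨n, hn'⟩ := Nat.exists_eq_add_of_le hn
  have hB := hdeg _ hn'
  rw [hs'] at hB hgs
  push_cast at e1 e2 e3 hB
  have hB' : B = m * n := by rw [hB]; ring
  subst hB'
  have e4 : g.coeff (t + 1 + 1) = - n * g.coeff (t + 1) := by
    apply mul_left_cancel₀ hm'
    linear_combination -e3
  have e5 : ((l + 1) * (t + 1) + m * n : k) * g.coeff (t + 1) = 0 := by
    rw [e4] at e2
    linear_combination (l + 1 - m * n : k) * e1 - (m : k) * e2
  have e6 := (mul_eq_zero.mp e5).resolve_right hgs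
  have : (l + 1) * (t + 1) + m * n = 0 := by exact_mod_cast e6
  simp at this

/-- The substitution `T ↦ x`, `v ↦ 1 + x ^ m y`. -/
noncomputable def blowupHom (k : Type*) [Field k] (m : ℕ) : k[X][X] →+* k[X][X] :=
  eval₂RingHom (aeval (1 + C X ^ m * X : k[X][X])).toRingHom (C X)

omit [CharZero k] in
theorem blowupHom_C (a : k[X]) : blowupHom k m (C a) = aeval (1 + C X ^ m * X : k[X][X]) a := by
  simp [blowupHom]

omit [CharZero k] in
theorem blowupHom_C_C (a : k) : blowupHom k m (C (C a)) = C (C a) := by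
  rw [blowupHom_C, aeval_C]; rfl

omit [CharZero k] in
theorem blowupHom_C_X : blowupHom k m (C X) = 1 + C X ^ m * X := by
  rw [blowupHom_C, aeval_X]

omit [CharZero k] in
theorem blowupHom_X : blowupHom k m X = C X := by
  simp [blowupHom]

omit [CharZero k] in
theorem blowupHom_map_C (a : k[X]) : blowupHom k m (a.map C) = C a := by
  induction a using Polynomial.induction_on' with
  | add p q hp hq => rw [Polynomial.map_add, map_add, hp, hq, C_add]
  | monomial n a =>
    rw [← C_mul_X_pow_eq_monomial, Polynomial.map_mul, Polynomial.map_pow, map_C, map_X, map_mul,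
      map_pow, blowupHom_C_C, blowupHom_X, C_mul, C_pow]

omit [CharZero k] in
theorem blowupHom_injective : Function.Injective (blowupHom k m) := by
  let K := FractionRing k[X][X]
  let ι : k[X][X] →+* K := algebraMap k[X][X] K
  have hX : ι X ≠ 0 := by
    rw [Ne, map_eq_zero_iff ι (IsFractionRing.injective _ _)]
    exact X_ne_zero
  let ψ : k[X][X] →+* K := eval₂RingHom (eval₂RingHom ((ι.comp C).comp C) (ι X))
    (ι (C X - 1) / ι X ^ m)
  have h : ψ.comp (blowupHom k m) = ι := by
    refine Polynomial.ringHom_ext' (Polynomial.ringHom_ext' ?_ ?_) ?_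
    · ext a
      simp [blowupHom_C_C, ψ]
    · have h1 : ψ (C X) = ι X := by simp [ψ]
      have h2 : ψ X = ι (C X - 1) / ι X ^ m := by simp [ψ]
      simp only [RingHom.comp_apply, blowupHom_C_X, map_add, map_one, map_mul, map_pow, h1, h2]
      rw [mul_div_cancel₀ _ (pow_ne_zero _ hX), map_sub, map_one]
      ring
    · simp [blowupHom_X, ψ]
  have h2 : Function.Injective (ψ.comp (blowupHom k m)) := by
    rw [h]; exact IsFractionRing.injective _ _
  exact Function.Injective.of_comp h2

omit [CharZero k] in
theorem exists_blowupHom_eq (F : k[X][X]) : ∃ N G, blowupHom k m G = C X ^ N * F := by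
  induction F using Polynomial.induction_on with
  | C a => exact ⟨0, a.map C, by rw [blowupHom_map_C]; ring⟩
  | add p q hp hq =>
    obtain ⟨N, G, hG⟩ := hp
    obtain ⟨N', G', hG'⟩ := hq
    refine ⟨N + N', X ^ N' * G + X ^ N * G', ?_⟩
    rw [map_add, map_mul, map_mul, hG, hG', map_pow, map_pow, blowupHom_X]
    ring
  | monomial n a ih =>
    obtain ⟨N, G, hG⟩ := ih
    refine ⟨N + m, G * C (X - 1), ?_⟩
    rw [map_mul, hG, C_sub, map_sub, blowupHom_C_X, C_1, map_one]
    ring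

omit [CharZero k] in
theorem C_X_mul_apply_C_X_pow (hx : δ (C X) = 1 + C X ^ m * X) (n : ℕ) :
    C X * δ (C X ^ n) = (n : k[X][X]) * (1 + C X ^ m * X) * C X ^ n := by
  rw [δ.leibniz_pow, hx]
  rcases n with _ | n
  · simp
  · simp only [smul_eq_mul, nsmul_eq_mul, Nat.add_sub_cancel]; ring

omit [CharZero k] in
theorem blowupHom_blowup (hx : δ (C X) = 1 + C X ^ m * X) (hy : δ X = C X ^ l) (G : k[X][X]) :
    blowupHom k m (blowup l m G) = C X * δ (blowupHom k m G) := by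
  have hv : C X * δ (1 + C X ^ m * X) =
      (m : k[X][X]) * (C X ^ m * X * (1 + C X ^ m * X)) + C X ^ (l + m + 1) := by
    rw [map_add, δ.map_one_eq_zero, δ.leibniz, δ.leibniz_pow, hx, hy]
    rcases m with _ | m
    · simp; ring
    · simp only [smul_eq_mul, nsmul_eq_mul, Nat.add_sub_cancel]
      ring
  induction G using Polynomial.induction_on' with
  | add p q hp hq =>
    rw [map_add, map_add, mul_add, ← hp, ← hq, ← map_add]
    congr 1
    simp only [blowup, map_add]
    ring
  | monomial n a =>
    have h1 : (derivative' : Derivation k k[X] k[X]).coeffwise (C a * X ^ n) =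
        C (derivative a) * X ^ n := by
      rw [leibniz, leibniz_pow, coeffwise_X, coeffwise_C, smul_zero, smul_zero, smul_zero, zero_add,
        smul_eq_mul, mul_comm]
      rfl
    have h3 : C X * X * derivative (C a * X ^ n) = (n : k[X][X]) * C (X * a) * X ^ n := by
      rw [derivative_C_mul, derivative_X_pow, C_eq_natCast, C_mul]
      rcases n with _ | n
      · simp
      · simp only [Nat.add_sub_cancel]; ring
    rw [← C_mul_X_pow_eq_monomial, blowup, h1, h3]
    have h4 : C X * δ (blowupHom k m (C a * X ^ n)) =
        blowupHom k m (C a) * ((n : k[X][X]) * (1 + C X ^ m * X) * C X ^ n) +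
        C X ^ n * (blowupHom k m (C (derivative a)) * (C X * δ (1 + C X ^ m * X))) := by
      rw [← C_X_mul_apply_C_X_pow hx, map_mul, map_pow, blowupHom_X, δ.leibniz, blowupHom_C,
        blowupHom_C, δ.map_aeval]
      simp only [smul_eq_mul]
      ring
    rw [h4, hv]
    simp only [map_add, map_mul, map_pow, map_sub, map_one, blowupHom_X, blowupHom_C_X,
      _root_.map_natCast]
    ring

/-- The coefficient of `y` in an eigenvalue. -/
theorem _root_.Polynomial.exists_eq_C_mul_X_pow {a b : k[X]} (hm : 0 < m) (ha : a ≠ 0)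
    (h : X ^ m * derivative a = b * a) : ∃ e, b = C e * X ^ (m - 1) := by
  by_cases hb : b = 0
  · exact ⟨0, by simp [hb]⟩
  have hd : derivative a ≠ 0 := fun h0 => mul_ne_zero hb ha (by rw [← h, h0, mul_zero])
  have h1 : b.natDegree ≤ m - 1 := by
    have h2 := congrArg natDegree h
    rw [natDegree_mul hb ha, natDegree_mul (pow_ne_zero _ X_ne_zero) hd, natDegree_X_pow] at h2
    have := natDegree_derivative_lt (p := a) fun h0 => hd (derivative_eq_zero.mpr h0)
    omega
  have h3 : m - 1 ≤ b.natTrailingDegree := by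
    have h2 := congrArg natTrailingDegree h
    rw [natTrailingDegree_mul hb ha, mul_comm, natTrailingDegree_mul_X_pow hd] at h2
    have : a.natTrailingDegree ≤ (derivative a).natTrailingDegree + 1 := by
      by_contra! hlt
      have h4 : (derivative a).coeff (derivative a).natTrailingDegree = 0 := by
        rw [coeff_derivative, coeff_eq_zero_of_lt_natTrailingDegree hlt, zero_mul]
      exact hd (trailingCoeff_eq_zero.mp h4)
    omega
  refine ⟨b.coeff (m - 1), ?_⟩
  ext i
  rw [coeff_C_mul_X_pow]
  split_ifs with hi
  · rw [hi]
  · rcases lt_or_gt_of_ne hi with hi | hi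
    · exact coeff_eq_zero_of_lt_natTrailingDegree (by omega)
    · exact coeff_eq_zero_of_natDegree_lt (by omega)

theorem eigenvalue_planar_eq_zero (hm : 0 < m) (hx : δ (C X) = 1 + C X ^ m * X)
    (hy : δ X = C X ^ l) {F Λ : k[X][X]} (hF : F ≠ 0) (h : δ F = Λ * F) : Λ = 0 := by
  by_contra hΛ
  have hdeg : Λ.natDegree ≤ 1 := by
    have h1 := natDegree_planar_le hx hy F
    rw [h, natDegree_mul hΛ hF] at h1
    omega
  obtain ⟨e, he⟩ : ∃ e, Λ.coeff 1 = C e * X ^ (m - 1) := by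
    refine exists_eq_C_mul_X_pow hm (leadingCoeff_ne_zero.mpr hF) ?_
    have h1 := coeff_succ_planar hx hy F F.natDegree
    rw [h, coeff_eq_zero_of_natDegree_lt (by omega : F.natDegree < F.natDegree + 1),
      coeff_eq_zero_of_natDegree_lt (by omega : F.natDegree < F.natDegree + 2), mul_comm,
      coeff_mul_add_eq_of_natDegree_le le_rfl hdeg] at h1
    rw [leadingCoeff, mul_comm, mul_comm (Λ.coeff 1), h1]
    simp [mul_comm]
  obtain ⟨N, G, hG⟩ := exists_blowupHom_eq (m := m) F
  have hG0 : G ≠ 0 := by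
    rintro rfl
    rw [map_zero, eq_comm, mul_eq_zero] at hG
    exact hG.elim (pow_ne_zero _ (C_ne_zero.mpr X_ne_zero)) hF
  obtain ⟨G₁, hG₁⟩ : X ^ G.natTrailingDegree ∣ G :=
    X_pow_dvd_iff.mpr fun d hd => coeff_eq_zero_of_lt_natTrailingDegree hd
  set r := G.natTrailingDegree with hr
  have hG₁0 : G₁.coeff 0 ≠ 0 := by
    have h1 : G.coeff r ≠ 0 := by rwa [hr, ← trailingCoeff, Ne, trailingCoeff_eq_zero]
    rwa [hG₁, ← zero_add r, coeff_X_pow_mul', if_pos le_rfl, Nat.sub_self] at h1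
  have hΛe : Λ = C (Λ.coeff 0) + C (C e) * C X ^ (m - 1) * X := by
    rw [← C_pow, ← C_mul, ← he, add_comm]
    exact eq_X_add_C_of_natDegree_le_one hdeg
  rw [hG₁, map_mul, map_pow, blowupHom_X] at hG
  set H := blowupHom k m G₁
  have hXr : (C X : k[X][X]) ^ r ≠ 0 := pow_ne_zero _ (C_ne_zero.mpr X_ne_zero)
  have hXm : (C X : k[X][X]) * C X ^ (m - 1) = C X ^ m := by
    rw [← pow_succ', Nat.sub_add_cancel hm]
  have key : blowup l m G₁ =
      (C (C ((N : k) - r) * X + C e * (X - 1)) + X * (Λ.coeff 0).map C) * G₁ := by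
    apply blowupHom_injective (m := m)
    rw [blowupHom_blowup hx hy]
    apply mul_left_cancel₀ hXr
    have h1 := congrArg (fun f => C X * δ f) hG
    simp only [δ.leibniz, smul_eq_mul, mul_add] at h1
    have h2 : blowupHom k m
        ((C (C ((N : k) - r) * X + C e * (X - 1)) + X * (Λ.coeff 0).map C) * G₁) =
        ((N - r : k[X][X]) * (1 + C X ^ m * X) + C X * Λ) * H := by
      conv_rhs => rw [hΛe]
      simp only [map_add, map_mul, map_sub, map_one, _root_.map_natCast, blowupHom_C_C,
        blowupHom_C_X, blowupHom_X, blowupHom_map_C]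
      linear_combination (- C (C e) * X * H) * hXm
    rw [h2]
    linear_combination h1 - H * C_X_mul_apply_C_X_pow hx r + F * C_X_mul_apply_C_X_pow hx N +
      C X * C X ^ N * h -
      ((N : k[X][X]) * (1 + C X ^ m * X) + C X * Λ) * hG
  obtain ⟨rfl, hK⟩ := eigenvalue_blowup_eq_zero hm hG₁0 key
  apply hΛ
  rw [hΛe, hK]
  simp

omit [CharZero k] in
theorem _root_.Polynomial.exists_dvd_C_mul {R : Type*} [CommRing R] [IsDomain R] {I : Ideal R[X]}
    {f : R[X]} (hf : f ∈ I) (hf0 : f ≠ 0)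
    (hmin : ∀ g ∈ I, g ≠ 0 → f.natDegree ≤ g.natDegree) {g : R[X]} (hg : g ∈ I) :
    ∃ a : R, a ≠ 0 ∧ f ∣ C a * g := by
  induction hn : g.degree using WellFoundedLT.induction generalizing g with
  | ind n ih =>
  subst hn
  by_cases hg0 : g = 0
  · exact ⟨1, one_ne_zero, by simp [hg0]⟩
  have hlf := leadingCoeff_ne_zero.mpr hf0
  have hlg := leadingCoeff_ne_zero.mpr hg0
  have hle := hmin g hg hg0
  set e := g.natDegree - f.natDegree
  have h1 : (C f.leadingCoeff * g).degree = (C g.leadingCoeff * X ^ e * f).degree := by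
    rw [degree_C_mul hlf, degree_mul, degree_C_mul_X_pow _ hlg, degree_eq_natDegree hg0,
      degree_eq_natDegree hf0, ← Nat.cast_add, Nat.sub_add_cancel hle]
  have h2 : (C f.leadingCoeff * g - C g.leadingCoeff * X ^ e * f).degree < g.degree := by
    rw [← degree_C_mul (p := g) hlf]
    refine degree_sub_lt_left h1 (mul_ne_zero (C_ne_zero.mpr hlf) hg0) ?_
    rw [leadingCoeff_mul, leadingCoeff_mul, leadingCoeff_C, leadingCoeff_C_mul_X_pow, mul_comm]
  obtain ⟨a, ha, hd⟩ := ih _ h2 (I.sub_mem (I.mul_mem_left _ hg) (I.mul_mem_left _ hf)) rfl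
  refine ⟨a * f.leadingCoeff, mul_ne_zero ha hlf, ?_⟩
  have h3 : C (a * f.leadingCoeff) * g = C a * (C f.leadingCoeff * g -
      C g.leadingCoeff * X ^ e * f) + f * (C a * (C g.leadingCoeff * X ^ e)) := by
    rw [C_mul]; ring
  rw [h3]
  exact dvd_add hd (dvd_mul_right _ _)

theorem _root_.Polynomial.IsPrimitive.dvd_of_dvd_C_mul {R : Type*} [CommRing R] [IsDomain R]
    [NormalizedGCDMonoid R] {p q : R[X]} (hp : p.IsPrimitive) {a : R} (ha : a ≠ 0)
    (h : p ∣ C a * q) : p ∣ q := by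
  by_cases hq : q = 0
  · simp [hq]
  have h0 : C a * q ≠ 0 := mul_ne_zero (C_ne_zero.mpr ha) hq
  rw [← hp.dvd_primPart_iff_dvd hq]
  rw [← hp.dvd_primPart_iff_dvd h0] at h
  have h1 := h.trans (associated_primPart_mul h0).dvd
  exact (isUnit_primPart_C a).dvd_mul_left.mp h1

/-- Stable ideals of the planar derivation contain nonzero polynomials in `x`. -/
theorem exists_C_mem_of_planar_stable (hm : 0 < m) (hlm : ¬ m ∣ l)
    (hx : δ (C X) = 1 + C X ^ m * X) (hy : δ X = C X ^ l) {I : Ideal k[X][X]} (hI0 : I ≠ ⊥)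
    (hI : ∀ f ∈ I, δ f ∈ I) : ∃ p : k[X], p ≠ 0 ∧ C p ∈ I := by
  classical
  let _ : NormalizedGCDMonoid k[X] := UniqueFactorizationMonoid.toNormalizedGCDMonoid k[X]
  have hex : ∃ N, ∃ f ∈ I, f ≠ 0 ∧ f.natDegree = N := by
    obtain ⟨f, hf, hf0⟩ := Submodule.exists_mem_ne_zero_of_ne_bot hI0
    exact ⟨_, f, hf, hf0, rfl⟩
  obtain ⟨f, hf, hf0, hfN⟩ := Nat.find_spec hex
  have hmin : ∀ g ∈ I, g ≠ 0 → f.natDegree ≤ g.natDegree := fun g hg hg0 => by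
    rw [hfN]; exact Nat.find_min' hex ⟨g, hg, hg0, rfl⟩
  have hc : f.content ≠ 0 := fun h => hf0 (content_eq_zero_iff.mp h)
  have hff := f.eq_C_content_mul_primPart
  have hp0 := f.primPart_ne_zero
  have hprim := f.isPrimitive_primPart
  set p := f.primPart
  set c := f.content
  have hdvd : p ∣ δ p := by
    obtain ⟨a, ha, h1⟩ := exists_dvd_C_mul hf hf0 hmin (hI f hf)
    have h2 : p ∣ C a * δ f := (Dvd.intro_left _ hff.symm).trans h1
    refine hprim.dvd_of_dvd_C_mul (mul_ne_zero ha hc) ?_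
    have h3 : C (a * c) * δ p = C a * δ f - p * (C a * δ (C c)) := by
      rw [hff, δ.leibniz, smul_eq_mul, smul_eq_mul, C_mul]; ring
    rw [h3]
    exact dvd_sub h2 (dvd_mul_right _ _)
  obtain ⟨Λ, hΛ⟩ := hdvd
  rw [mul_comm] at hΛ
  have hΛ0 := eigenvalue_planar_eq_zero hm hx hy hp0 hΛ
  rw [hΛ0, zero_mul] at hΛ
  obtain ⟨b, hb⟩ := onlyScalarPrimitives_planar hm hlm hx hy p 0 (by rw [hΛ, map_zero])
  refine ⟨c * C b, fun h0 => hf0 ?_, ?_⟩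
  · rw [hff, hb, Polynomial.algebraMap_apply, Polynomial.algebraMap_apply, ← C_mul,
      Algebra.algebraMap_self_apply, h0, C_0]
  · rwa [hff, hb, Polynomial.algebraMap_apply, Polynomial.algebraMap_apply, ← C_mul] at hf

omit [CharZero k] in
theorem apply_C_of_planar (hx : δ (C X) = 1 + C X ^ m * X) (hy : δ X = C X ^ l) (a : k[X]) :
    δ (C a) = (1 + C X ^ m * X) * C (derivative a) := by
  rw [planar_apply hx hy, coeffwise_C, derivative_C, mul_zero, add_zero]
  rfl

theorem exists_pow_mem_of_planar_stable (hx : δ (C X) = 1 + C X ^ m * X) (hy : δ X = C X ^ l)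
    {I : Ideal k[X][X]} (hI : ∀ f ∈ I, δ f ∈ I) {p : k[X]} (hp : p ≠ 0) {r : ℕ}
    (h : (1 + C X ^ m * X) ^ r * C p ∈ I) : ∃ r, (1 + C X ^ m * X : k[X][X]) ^ r ∈ I := by
  induction hn : p.natDegree generalizing p r with
  | zero =>
    rw [eq_C_of_natDegree_eq_zero hn] at h hp
    refine ⟨r, ?_⟩
    have := I.mul_mem_right (C (C (p.coeff 0)⁻¹)) h
    rwa [mul_assoc, ← C_mul, ← C_mul, mul_inv_cancel₀ (by simpa using hp), C_1, C_1,
      mul_one] at this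
  | succ n ih =>
    have h1 : derivative p ≠ 0 := fun h => by rw [derivative_eq_zero] at h; omega
    refine ih (p := derivative p) (r := r + 2) h1 ?_ ?_
    · have h2 := I.sub_mem (I.mul_mem_left (1 + C X ^ m * X) (hI _ h))
        (I.mul_mem_left (r * δ (1 + C X ^ m * X)) h)
      convert h2 using 1
      rw [δ.leibniz, apply_C_of_planar hx hy, δ.leibniz_pow, smul_eq_mul, smul_eq_mul, smul_eq_mul,
        nsmul_eq_mul]
      rcases r with _ | r
      · simp; ring
      · simp only [Nat.add_sub_cancel]; push_cast; ring
    · rw [natDegree_derivative, hn, Nat.add_sub_cancel]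

theorem isSimple_planar (hm : 0 < m) (hlm : ¬ m ∣ l)
    (hx : δ (C X) = 1 + C X ^ m * X) (hy : δ X = C X ^ l) : δ.IsSimple := by
  intro I hI
  by_cases hI0 : I = ⊥
  · exact Or.inl hI0
  refine Or.inr ((Ideal.eq_top_iff_one I).mpr ?_)
  obtain ⟨p, hp, hpI⟩ := exists_C_mem_of_planar_stable hm hlm hx hy hI0 hI
  obtain ⟨r, hr⟩ := exists_pow_mem_of_planar_stable hx hy hI hp (r := 0) (by simpa using hpI)
  have h2 := δ.pow_apply_mem_of_pow_mem hI hr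
  have hcop : IsCoprime (1 + C X ^ m * X : k[X][X]) (C X) := by
    obtain ⟨m, rfl⟩ := Nat.exists_eq_add_of_lt hm
    exact ⟨1, - (C X ^ m * X), by ring⟩
  have hcop2 : IsCoprime (1 + C X ^ m * X : k[X][X]) (δ (1 + C X ^ m * X)) := by
    have : δ (1 + C X ^ m * X) = C X ^ (m + l) +
        (1 + C X ^ m * X) * ((m : k[X][X]) * C X ^ (m - 1) * X) := by
      rw [map_add, δ.map_one_eq_zero, δ.leibniz, δ.leibniz_pow, hx, hy]
      simp only [smul_eq_mul, nsmul_eq_mul]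
      ring
    rw [this]
    exact IsCoprime.add_mul_left_right hcop.pow_right _
  obtain ⟨a, b, hab⟩ := hcop2.pow (m := r) (n := 2 * r)
  rw [← hab]
  exact I.add_mem (I.mul_mem_left _ hr) (I.mul_mem_left _ h2)

theorem orbit_planar_of_degree_zero_one (hm : 0 < m) (hl : 0 < l)
    (hx : δ (C X) = 1 + C X ^ m * X) (hy : δ X = C X ^ l) {a p q : k[X]}
    (hu : δ (C a) = 1 + C a ^ m * (C q * X + C p)) (hw : δ (C q * X + C p) = C a ^ l) :
    C a = (C X : k[X][X]) ∧ C q * X + C p = X := by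
  have hw0 := coeff_zero_planar hx hy (C q * X + C p)
  have hw1 := coeff_succ_planar hx hy (C q * X + C p) 0
  have hw2 := coeff_succ_planar hx hy (C q * X + C p) 1
  have hu0 := coeff_zero_planar hx hy (C a)
  have hu1 := coeff_succ_planar hx hy (C a) 0
  have e0 : (C q * X + C p).coeff 0 = p := by simp
  have e1 : (C q * X + C p).coeff 1 = q := by simp
  have e2 : (C q * X + C p).coeff 2 = 0 := by simp
  have e3 : (C q * X + C p).coeff (1 + 2) = 0 := by simp
  rw [hw, ← C_pow] at hw0 hw1 hw2
  rw [hu, ← C_pow, add_comm, coeff_add, coeff_C_mul] at hu0 hu1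
  simp only [e0, e1, zero_add, one_add_one_eq_two, e2, e3, coeff_C_zero, coeff_C_succ,
    coeff_one, if_neg one_ne_zero, add_zero, mul_zero, derivative_zero,
    coeff_C_of_ne_zero two_ne_zero] at hw0 hw1 hw2 hu0 hu1
  have hz : ∀ {c : k[X]}, derivative c = 0 → c = C (c.coeff 0) := fun {c} h =>
    eq_C_of_natDegree_eq_zero (derivative_eq_zero.mp h)
  have hX : (X ^ m : k[X]) ≠ 0 := pow_ne_zero _ X_ne_zero
  have hq' : derivative q = 0 := (mul_eq_zero.mp hw2.symm).resolve_left hX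
  rw [hq', zero_add] at hw1
  have hp' : derivative p = 0 := (mul_eq_zero.mp hw1.symm).resolve_left hX
  have hq := hz hq'
  have hp := hz hp'
  rw [hp', zero_add] at hw0
  generalize q.coeff 0 = q₀ at hq
  generalize p.coeff 0 = p₀ at hp
  subst hq hp
  have ha : a ≠ 0 := by
    rintro rfl
    rw [zero_pow hm.ne', zero_mul, derivative_zero] at hu0
    simp at hu0
  have hq₀ : q₀ ≠ 0 := by
    rintro rfl
    rw [C_0, mul_zero] at hw0
    exact pow_ne_zero _ ha hw0
  have hdeg : a.natDegree ≤ 1 := by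
    have h1 := congrArg natDegree hw0
    rw [natDegree_pow, natDegree_mul_C hq₀, natDegree_X_pow] at h1
    exact (Nat.eq_of_mul_eq_mul_left hl (h1.trans (mul_one l).symm)).le
  have ha0 : a.coeff 0 = 0 := by
    have h1 := congrArg (coeff · 0) hw0
    simpa [coeff_zero_eq_eval_zero, hl.ne'] using h1
  have haX := eq_X_add_C_of_natDegree_le_one hdeg
  rw [ha0, C_0, add_zero] at haX
  generalize a.coeff 1 = β at haX
  subst haX
  have hβ : X ^ m * C (β ^ m * p₀) = C (β - 1) := by
    rw [derivative_C_mul, derivative_X, mul_one, mul_pow] at hu0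
    rw [C_sub, ← hu0, C_mul, C_pow]
    simp
    ring
  have h1 := eq_zero_of_X_pow_mul_eq_C hm hβ
  rw [h1, mul_zero, eq_comm, C_eq_zero, sub_eq_zero] at hβ
  rw [hβ, one_pow, one_mul, C_eq_zero] at h1
  have h2 : X ^ l * C q₀ = X ^ l * (1 : k[X]) := by
    rw [← hw0, hβ, C_1, one_mul, mul_one]
  rw [h1, hβ, mul_left_cancel₀ (pow_ne_zero _ X_ne_zero) h2]
  simp

theorem orbit_planar_eq (hm : 0 < m) (hl : 0 < l) (hlm : ¬ m ∣ l)
    (hx : δ (C X) = 1 + C X ^ m * X) (hy : δ X = C X ^ l) {u w : k[X][X]}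
    (hu : δ u = 1 + u ^ m * w) (hw : δ w = u ^ l) : u = C X ∧ w = X := by
  have hm2 : 2 ≤ m := by
    by_contra h
    obtain rfl : m = 1 := by omega
    exact hlm (one_dvd l)
  have hu0 : u ≠ 0 := by
    rintro rfl
    rw [map_zero, zero_pow hm.ne', zero_mul, add_zero] at hu
    exact zero_ne_one hu
  have hw0 : w ≠ 0 := by
    rintro rfl
    rw [map_zero] at hw
    exact pow_ne_zero l hu0 hw.symm
  have h1 : m * u.natDegree + w.natDegree ≤ u.natDegree + 1 := by
    have h2 : u ^ m * w = δ u - 1 := by rw [hu]; ring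
    rw [← natDegree_pow, ← natDegree_mul (pow_ne_zero _ hu0) hw0, h2]
    exact (natDegree_sub_le _ _).trans (by simpa using natDegree_planar_le hx hy u)
  have h2 : l * u.natDegree ≤ w.natDegree + 1 := by
    rw [← natDegree_pow, ← hw]
    exact natDegree_planar_le hx hy w
  have h3 : u.natDegree ≤ 1 := by nlinarith
  rcases Nat.lt_or_ge u.natDegree 1 with h4 | h4
  · have h5 : u.natDegree = 0 := by omega
    rw [eq_C_of_natDegree_eq_zero h5] at hu hw ⊢
    rw [eq_X_add_C_of_natDegree_le_one (p := w) (by rw [h5] at h1; omega)] at hu hw ⊢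
    exact orbit_planar_of_degree_zero_one hm hl hx hy hu hw
  · exfalso
    have h5 : u.natDegree = 1 := by omega
    rw [h5] at h1 h2
    obtain rfl : m = 2 := by omega
    obtain rfl : l = 1 := by omega
    have h6 : w.natDegree = 0 := by omega
    rw [eq_C_of_natDegree_eq_zero h6, apply_C_of_planar hx hy] at hw
    rw [eq_C_of_natDegree_eq_zero h6] at hu
    set b := w.coeff 0
    rw [pow_one] at hw
    have h7 : derivative b ≠ 0 := fun h => hu0 (by rw [← hw, h, C_0, mul_zero])
    have h8 : 0 < b.natDegree := Nat.pos_of_ne_zero fun h => h7 (derivative_eq_zero.mpr h)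
    have h9 : u = C (X ^ 2 * derivative b) * X + C (derivative b) := by
      rw [← hw, C_mul, C_pow]; ring
    have h10 := coeff_succ_planar hx hy u 1
    have h12 : u.coeff 1 = X ^ 2 * derivative b := by
      rw [h9, coeff_add, coeff_C_mul, coeff_X_one, coeff_C_succ, mul_one, add_zero]
    have h11 : (1 + u ^ 2 * C b).coeff 2 = (X ^ 2 * derivative b) ^ 2 * b := by
      rw [coeff_add, coeff_mul_C, coeff_one, if_neg two_ne_zero, zero_add,
        show (2 : ℕ) = 2 * 1 from rfl, coeff_pow_of_natDegree_le h3, h12]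
    rw [hu, h11, coeff_eq_zero_of_natDegree_lt (by omega : u.natDegree < 1 + 1),
      coeff_eq_zero_of_natDegree_lt (by omega : u.natDegree < 1 + 2), mul_zero, mul_zero,
      derivative_zero, zero_add, add_zero] at h10
    have hX2 : (X ^ 2 : k[X]) ≠ 0 := pow_ne_zero _ X_ne_zero
    rw [h12] at h10
    have h13 := congrArg natDegree h10
    rw [natDegree_mul (pow_ne_zero _ (mul_ne_zero hX2 h7)) (ne_zero_of_natDegree_gt h8),
      natDegree_pow, natDegree_mul hX2 h7, natDegree_X_pow] at h13
    have h14 : (X ^ 2 * derivative (X ^ 2 * derivative b)).natDegree ≤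
        2 + (2 + (derivative b).natDegree) := by
      refine natDegree_mul_le.trans ?_
      rw [natDegree_X_pow]
      refine Nat.add_le_add_left ((natDegree_derivative_le _).trans ?_) _
      rw [natDegree_mul hX2 h7, natDegree_X_pow]
      omega
    omega

end Derivation

end Planar

end

namespace Derivation

section Conj

variable {k R S : Type*} [CommRing k] [CommRing R] [CommRing S] [Algebra k R] [Algebra k S]

/-- The derivation obtained by transport along an algebra isomorphism. -/
noncomputable def conj (e : R ≃ₐ[k] S) (D : Derivation k S S) : Derivation k R R :=
  Derivation.mk' (e.symm.toLinearMap ∘ₗ D.toLinearMap ∘ₗ e.toLinearMap) fun a b => by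
    simp

theorem conj_apply (e : R ≃ₐ[k] S) (D : Derivation k S S) (a : R) :
    D.conj e a = e.symm (D (e a)) := rfl

theorem apply_conj (e : R ≃ₐ[k] S) (D : Derivation k S S) (a : R) :
    e (D.conj e a) = D (e a) := e.apply_symm_apply _

theorem IsSimple.conj {D : Derivation k S S} (hD : D.IsSimple) (e : R ≃ₐ[k] S) :
    (D.conj e).IsSimple := by
  intro I hI
  refine (hD (I.comap e.symm) fun f hf => ?_).imp (fun h => ?_) fun h => ?_
  · have := hI _ hf
    rwa [conj_apply, e.apply_symm_apply] at this
  · rw [eq_bot_iff]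
    intro a ha
    have : e a ∈ I.comap e.symm := by simpa using ha
    rw [h, Ideal.mem_bot] at this
    simpa using this
  · rw [Ideal.eq_top_iff_one] at h ⊢
    simpa using h

theorem OnlyScalarPrimitives.conj {k R S : Type*} [Field k] [CommRing R] [CommRing S] [Algebra k R]
    [Algebra k S] {D : Derivation k S S} {e : R ≃ₐ[k] S} {t : R}
    (hD : D.OnlyScalarPrimitives (e t)) : (D.conj e).OnlyScalarPrimitives t := by
  intro a q ha
  obtain ⟨c, hc⟩ := hD (e a) q (by
    rw [← apply_conj, ha, Polynomial.aeval_algHom_apply])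
  exact ⟨c, e.injective (by rw [hc, e.commutes])⟩

end Conj

/-- The derivation `(1 + x ^ m y) ∂_x + x ^ l ∂_y`, where `y` is the outer variable. -/
noncomputable def planar (k : Type*) [Field k] (l m : ℕ) :
    Derivation k (Polynomial (Polynomial k)) (Polynomial (Polynomial k)) :=
  (1 + Polynomial.C Polynomial.X ^ m * Polynomial.X : Polynomial (Polynomial k)) •
      (Polynomial.derivative' : Derivation k (Polynomial k) (Polynomial k)).coeffwise +
    (Polynomial.C Polynomial.X ^ l : Polynomial (Polynomial k)) •
      (Polynomial.derivative' : Derivation (Polynomial k) (Polynomial (Polynomial k))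
        (Polynomial (Polynomial k))).restrictScalars k

theorem planar_C_X (k : Type*) [Field k] (l m : ℕ) :
    planar k l m (Polynomial.C Polynomial.X) =
      1 + Polynomial.C Polynomial.X ^ m * Polynomial.X := by
  rw [planar, add_apply, smul_apply, smul_apply, coeffwise_C, restrictScalars_apply,
    Polynomial.derivative'_apply, Polynomial.derivative'_apply, Polynomial.derivative_C,
    Polynomial.derivative_X, Polynomial.C_1, smul_eq_mul, smul_zero, mul_one, add_zero]

theorem planar_X (k : Type*) [Field k] (l m : ℕ) :
    planar k l m Polynomial.X = Polynomial.C Polynomial.X ^ l := by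
  rw [planar, add_apply, smul_apply, smul_apply, coeffwise_X, restrictScalars_apply,
    Polynomial.derivative'_apply, Polynomial.derivative_X, smul_eq_mul, mul_zero, smul_eq_mul,
    mul_one, zero_add]

end Derivation

namespace MvPolynomial

/-- Multivariate polynomials as univariate polynomials in the last variable. -/
noncomputable def lastEquiv (k : Type*) [CommRing k] (n : ℕ) :
    MvPolynomial (Fin (n + 1)) k ≃ₐ[k] Polynomial (MvPolynomial (Fin n) k) :=
  (renameEquiv k finSuccEquivLast).trans (optionEquivLeft k (Fin n))

section

variable {k : Type*} [CommRing k] {n : ℕ}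

theorem lastEquiv_rename (f : MvPolynomial (Fin n) k) :
    lastEquiv k n (rename Fin.castSucc f) = Polynomial.C f := by
  have : (lastEquiv k n).toAlgHom.comp (rename Fin.castSucc) = Polynomial.CAlgHom := by
    ext i
    simp [lastEquiv]
  exact DFunLike.congr_fun this f

theorem lastEquiv_X_last : lastEquiv k n (X (Fin.last n)) = Polynomial.X := by
  simp [lastEquiv]

theorem lastEquiv_X_castSucc (i : Fin n) :
    lastEquiv k n (X i.castSucc) = Polynomial.C (X i) := by
  simp [lastEquiv]

theorem lastEquiv_C (c : k) : lastEquiv k n (C c) = Polynomial.C (C c) :=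
  (lastEquiv k n).commutes c

end

/-- Polynomials in two variables as iterated univariate polynomials. -/
noncomputable def finTwoEquiv (k : Type*) [CommRing k] :
    MvPolynomial (Fin 2) k ≃ₐ[k] Polynomial (Polynomial k) :=
  (lastEquiv k 1).trans (Polynomial.mapAlgEquiv (uniqueAlgEquiv k (Fin 1)))

theorem finTwoEquiv_X_zero (k : Type*) [CommRing k] :
    finTwoEquiv k (X 0) = Polynomial.C Polynomial.X := by
  have := lastEquiv_X_castSucc (k := k) (0 : Fin 1)
  rw [Fin.castSucc_zero] at this
  simp [finTwoEquiv, this, uniqueAlgEquiv]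

theorem finTwoEquiv_X_one (k : Type*) [CommRing k] :
    finTwoEquiv k (X 1) = Polynomial.X := by
  have := lastEquiv_X_last (k := k) (n := 1)
  rw [show Fin.last 1 = 1 from rfl] at this
  simp [finTwoEquiv, this]

/-- The derivation in `n + 2` variables obtained from the planar one by adding
`g i (x_{i+1}) ∂_{i+2}` for `i < n`. -/
noncomputable def tower {k : Type*} [Field k] (l m : ℕ) (g : ℕ → Polynomial k) : ∀ n : ℕ,
    Derivation k (MvPolynomial (Fin (n + 2)) k) (MvPolynomial (Fin (n + 2)) k)
  | 0 => (Derivation.planar k l m).conj (finTwoEquiv k)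
  | n + 1 => ((tower l m g n).extend
      (Polynomial.C (Polynomial.aeval (X (Fin.last (n + 1))) (g n)))).conj (lastEquiv k (n + 2))

section Tower

variable {k : Type*} [Field k] {l m n : ℕ} {g : ℕ → Polynomial k}

theorem rename_aeval_X {σ τ : Type*} (f : σ → τ) (i : σ) (p : Polynomial k) :
    rename f (Polynomial.aeval (X i : MvPolynomial σ k) p) = Polynomial.aeval (X (f i)) p := by
  rw [← Polynomial.aeval_algHom_apply, rename_X]

theorem tower_zero_X_zero : tower l m g 0 (X 0) = 1 + X 0 ^ m * X 1 := by
  apply (finTwoEquiv k).injective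
  change finTwoEquiv k (Derivation.conj _ _ _) = _
  rw [Derivation.apply_conj, finTwoEquiv_X_zero, Derivation.planar_C_X]
  simp [finTwoEquiv_X_zero, finTwoEquiv_X_one]

theorem tower_zero_X_one : tower l m g 0 (X 1) = X 0 ^ l := by
  apply (finTwoEquiv k).injective
  change finTwoEquiv k (Derivation.conj _ _ _) = _
  rw [Derivation.apply_conj, finTwoEquiv_X_one, Derivation.planar_X]
  simp [finTwoEquiv_X_zero]

theorem tower_rename (f : MvPolynomial (Fin (n + 2)) k) :
    tower l m g (n + 1) (rename Fin.castSucc f) = rename Fin.castSucc (tower l m g n f) := by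
  apply (lastEquiv k (n + 2)).injective
  change lastEquiv k (n + 2) (Derivation.conj _ _ _) = _
  rw [Derivation.apply_conj, lastEquiv_rename, lastEquiv_rename, Derivation.extend_apply,
    Derivation.coeffwise_C]
  simp

theorem tower_X_castSucc (i : Fin (n + 2)) :
    tower l m g (n + 1) (X i.castSucc) = rename Fin.castSucc (tower l m g n (X i)) := by
  rw [← tower_rename, rename_X]

theorem tower_X_last : tower l m g (n + 1) (X (Fin.last (n + 2))) =
    Polynomial.aeval (X (Fin.last (n + 1)).castSucc) (g n) := by
  apply (lastEquiv k (n + 2)).injective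
  change lastEquiv k (n + 2) (Derivation.conj _ _ _) = _
  rw [Derivation.apply_conj, lastEquiv_X_last, Derivation.extend_apply, Derivation.coeffwise_X,
    ← rename_aeval_X, lastEquiv_rename, Polynomial.derivative_X, zero_add, mul_one]

theorem lastEquiv_tower (f : MvPolynomial (Fin (n + 3)) k) :
    lastEquiv k (n + 2) (tower l m g (n + 1) f) = (tower l m g n).extend
      (Polynomial.C (Polynomial.aeval (X (Fin.last (n + 1))) (g n))) (lastEquiv k (n + 2) f) :=
  Derivation.apply_conj _ _ f

theorem extend_tower_C (p : Polynomial (MvPolynomial (Fin (n + 2)) k))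
    (a : MvPolynomial (Fin (n + 2)) k) :
    (tower l m g n).extend p (Polynomial.C a) = Polynomial.C (tower l m g n a) := by
  rw [Derivation.extend_apply, Derivation.coeffwise_C, Polynomial.derivative_C, mul_zero, add_zero]

theorem extend_tower_X (p : Polynomial (MvPolynomial (Fin (n + 2)) k)) :
    (tower l m g n).extend p Polynomial.X = p := by
  rw [Derivation.extend_apply, Derivation.coeffwise_X, Polynomial.derivative_X, mul_one, zero_add]

theorem onlyScalarPrimitives_tower [CharZero k] (hm : 0 < m) (hlm : ¬ m ∣ l)
    (hg : ∀ i, 0 < (g i).natDegree) (n : ℕ) :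
    (tower l m g n).OnlyScalarPrimitives (X (Fin.last (n + 1))) := by
  induction n with
  | zero =>
    apply Derivation.OnlyScalarPrimitives.conj
    rw [show X (Fin.last (0 + 1)) = (X 1 : MvPolynomial (Fin 2) k) from rfl, finTwoEquiv_X_one]
    exact Derivation.onlyScalarPrimitives_planar hm hlm (Derivation.planar_C_X k l m)
      (Derivation.planar_X k l m)
  | succ n ih =>
    apply Derivation.OnlyScalarPrimitives.conj
    rw [lastEquiv_X_last]
    exact ih.of_C_X (transcendental_X k _) (hg n) (extend_tower_C _) (extend_tower_X _)

theorem isSimple_tower [CharZero k] (hm : 0 < m) (hlm : ¬ m ∣ l)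
    (hg : ∀ i, 0 < (g i).natDegree) (n : ℕ) : (tower l m g n).IsSimple := by
  induction n with
  | zero =>
    exact (Derivation.isSimple_planar hm hlm (Derivation.planar_C_X k l m)
      (Derivation.planar_X k l m)).conj _
  | succ n ih =>
    refine (ih.of_C_X (extend_tower_C _) (extend_tower_X _) fun r hr => ?_).conj _
    have h1 := (onlyScalarPrimitives_tower hm hlm hg n).eq_zero_of_add (a := - r) (α := 1) (γ := 0)
      (transcendental_X k _) (hg n) (by rw [map_neg, hr]; simp)
    exact one_ne_zero h1.1

theorem orbit_tower_eq [CharZero k] (hl : 0 < l) (hm : 0 < m) (hlm : ¬ m ∣ l)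
    {u w : MvPolynomial (Fin (n + 2)) k} (hu : tower l m g n u = 1 + u ^ m * w)
    (hw : tower l m g n w = u ^ l) : u = X 0 ∧ w = X 1 := by
  induction n with
  | zero =>
    have h1 := congrArg (finTwoEquiv k) hu
    have h2 := congrArg (finTwoEquiv k) hw
    have h3 : ∀ f, finTwoEquiv k (tower l m g 0 f) = Derivation.planar k l m (finTwoEquiv k f) :=
      Derivation.apply_conj _ _
    rw [h3] at h1 h2
    rw [map_add, map_one, map_mul, map_pow] at h1
    rw [map_pow] at h2
    have h4 := Derivation.orbit_planar_eq hm hl hlm (Derivation.planar_C_X k l m)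
      (Derivation.planar_X k l m) h1 h2
    rwa [← finTwoEquiv_X_zero, ← finTwoEquiv_X_one, (finTwoEquiv k).injective.eq_iff,
      (finTwoEquiv k).injective.eq_iff] at h4
  | succ n ih =>
    have h1 := congrArg (lastEquiv k (n + 2)) hu
    have h2 := congrArg (lastEquiv k (n + 2)) hw
    rw [lastEquiv_tower] at h1 h2
    rw [map_add, map_one, map_mul, map_pow] at h1
    rw [map_pow] at h2
    obtain ⟨a, b, ha, hb⟩ := Derivation.exists_eq_C_of_orbit (extend_tower_C _) (extend_tower_X _)
      hl hm h1 h2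
    rw [ha, hb, extend_tower_C, ← map_pow, ← map_mul, ← Polynomial.C_1, ← map_add,
      Polynomial.C_inj] at h1
    rw [ha, hb, extend_tower_C, ← map_pow, Polynomial.C_inj] at h2
    obtain ⟨rfl, rfl⟩ := ih h1 h2
    constructor
    · apply (lastEquiv k (n + 2)).injective
      rw [ha, ← lastEquiv_X_castSucc, Fin.castSucc_zero]
    · apply (lastEquiv k (n + 2)).injective
      rw [hb, ← lastEquiv_X_castSucc, Fin.castSucc_one]

theorem exists_eq_sum_of_tower_apply [CharZero k] (hm : 0 < m) (hlm : ¬ m ∣ l)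
    (hg : ∀ i, 0 < (g i).natDegree) {f : MvPolynomial (Fin (n + 2)) k}
    (h : Fin (n + 1) → Polynomial k)
    (hf : tower l m g n f = ∑ j : Fin (n + 1), Polynomial.aeval (X j.succ) (h j)) :
    ∃ (c : k) (b : Fin n → k), f = C c + ∑ j : Fin n, C (b j) * X j.succ.succ := by
  induction n with
  | zero =>
    obtain ⟨c, hc⟩ := onlyScalarPrimitives_tower hm hlm hg 0 f (h 0) (by
      rw [hf, Fin.sum_univ_one]; rfl)
    exact ⟨c, Fin.elim0, by simpa using hc⟩
  | succ n ih =>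
    have h1 := congrArg (lastEquiv k (n + 2)) hf
    have h2 : ∀ j : Fin (n + 1), lastEquiv k (n + 2) (Polynomial.aeval (X j.castSucc.succ)
        (h j.castSucc)) = Polynomial.C (Polynomial.aeval (X j.succ) (h j.castSucc)) := fun j => by
      rw [Fin.succ_castSucc, ← rename_aeval_X, lastEquiv_rename]
    have h3 : lastEquiv k (n + 2) (Polynomial.aeval (X (Fin.last (n + 1)).succ)
        (h (Fin.last (n + 1)))) = (h (Fin.last (n + 1))).map (algebraMap k _) := by
      rw [← Polynomial.aeval_algHom_apply, Fin.succ_last, lastEquiv_X_last,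
        Polynomial.aeval_X_left_eq_map]
    rw [lastEquiv_tower, Fin.sum_univ_castSucc, map_add, map_sum, h3, Finset.sum_congr rfl
      fun j _ => h2 j, ← map_sum] at h1
    obtain ⟨a, α, ha⟩ := (onlyScalarPrimitives_tower hm hlm hg n).eq_C_add (transcendental_X k _)
      (hg n) (extend_tower_C _) (extend_tower_X _) (f := lastEquiv k (n + 2) f) (fun i =>
        ⟨(h (Fin.last (n + 1))).coeff (i + 1), by
          rw [h1, Polynomial.coeff_add, Polynomial.coeff_C_succ, zero_add, Polynomial.coeff_map]⟩)
    have h4 := congrArg (Polynomial.coeff · 0) h1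
    beta_reduce at h4
    rw [ha, map_add, Derivation.leibniz, extend_tower_C, extend_tower_C, extend_tower_X,
      Derivation.map_algebraMap, Polynomial.C_0, smul_zero, add_zero, smul_eq_mul,
      ← Polynomial.C_mul, ← Polynomial.C_add, Polynomial.coeff_C_zero, Polynomial.coeff_add,
      Polynomial.coeff_C_zero, Polynomial.coeff_map] at h4
    obtain ⟨c, b, rfl⟩ := ih (f := a) (fun j => h j.castSucc + if j = Fin.last n then
        Polynomial.C ((h (Fin.last (n + 1))).coeff 0) - Polynomial.C α * g n else 0) (by
      rw [eq_sub_of_add_eq h4]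
      simp only [map_add, Finset.sum_add_distrib]
      rw [Fin.sum_univ_castSucc (n := n) (f := fun j => Polynomial.aeval _ (ite _ _ _))]
      simp [Fin.castSucc_ne_last, add_sub_assoc])
    refine ⟨c, Fin.snoc b α, (lastEquiv k (n + 2)).injective ?_⟩
    rw [ha, Fin.sum_univ_castSucc]
    simp [lastEquiv_X_last, ← Fin.castSucc_succ, lastEquiv_X_castSucc, lastEquiv_C, add_assoc]

end Tower

end MvPolynomial

namespace Polynomial

theorem eq_zero_of_taylor_eq_self {k : Type*} [Field k] [CharZero k] {p : Polynomial k}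
    (hp : 0 < p.natDegree) {c : k} (h : taylor c p = p) : c = 0 := by
  by_contra hc
  have h1 : ∀ x, p.eval (x + c) = p.eval x := fun x => by rw [← taylor_eval, h]
  have h2 : ∀ n : ℕ, p.eval (n * c) = p.eval 0 := fun n => by
    induction n with
    | zero => simp
    | succ n ih => rw [Nat.cast_succ, add_one_mul, h1, ih]
  have h3 : p = C (p.eval 0) := by
    refine eq_of_infinite_eval_eq _ _ (Set.infinite_of_injective_forall_mem
      (f := fun n : ℕ => (n : k) * c) (fun a b hab => ?_) fun n => ?_)
    · exact Nat.cast_injective (mul_right_cancel₀ hc hab)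
    · simp only [Set.mem_ofPred_eq, eval_C]; exact h2 n
  rw [h3, natDegree_C] at hp
  exact lt_irrefl _ hp

end Polynomial

namespace MvPolynomial

section

variable {k : Type*} [Field k]

theorem aeval_single_aeval_self {σ : Type*} [DecidableEq σ] (i : σ) (p : Polynomial k) :
    aeval (Pi.single i Polynomial.X : σ → Polynomial k)
      (Polynomial.aeval (X i : MvPolynomial σ k) p) = p := by
  rw [← Polynomial.aeval_algHom_apply, aeval_X, Pi.single_eq_same, Polynomial.aeval_X_left_apply]

theorem coeff_aeval_single_aeval_of_ne {σ : Type*} [DecidableEq σ] {i j : σ} (hij : j ≠ i)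
    (p : Polynomial k) {d : ℕ} (hd : 0 < d) :
    (aeval (Pi.single i Polynomial.X : σ → Polynomial k)
      (Polynomial.aeval (X j : MvPolynomial σ k) p)).coeff d = 0 := by
  rw [← Polynomial.aeval_algHom_apply, aeval_X, Pi.single_eq_of_ne hij,
    ← map_zero (algebraMap k (Polynomial k)), Polynomial.aeval_algebraMap_apply]
  exact Polynomial.coeff_C_of_ne_zero hd.ne'

variable {l m n : ℕ} {g : ℕ → Polynomial k}

theorem tower_X_zero : tower l m g n (X 0) = 1 + X 0 ^ m * X 1 := by
  induction n with
  | zero => exact tower_zero_X_zero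
  | succ n ih =>
    rw [← Fin.castSucc_zero, tower_X_castSucc, ih]
    simp

theorem tower_X_one : tower l m g n (X 1) = X 0 ^ l := by
  induction n with
  | zero => exact tower_zero_X_one
  | succ n ih =>
    rw [← Fin.castSucc_one, tower_X_castSucc, ih]
    simp

theorem tower_X_succ_succ (j : Fin n) : tower l m g n (X j.succ.succ) =
    Polynomial.aeval (X j.castSucc.succ) (g j) := by
  induction n with
  | zero => exact j.elim0
  | succ n ih =>
    induction j using Fin.lastCases with
    | last => exact tower_X_last
    | cast j =>
      rw [← Fin.castSucc_succ, ← Fin.castSucc_succ, tower_X_castSucc, ih, rename_aeval_X]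
      rfl

/-- If an automorphism commuting with the tower translates `x_{i+1}` by a constant, that constant
is zero unless `x_{i+1}` is the last variable. -/
theorem eq_zero_of_translate [CharZero k] (hm : 0 < m) (hlm : ¬ m ∣ l)
    (hg : ∀ i, 0 < (g i).natDegree)
    {ρ : MvPolynomial (Fin (n + 2)) k →ₐ[k] MvPolynomial (Fin (n + 2)) k}
    (hρ : ∀ f, ρ (tower l m g n f) = tower l m g n (ρ f)) (i : Fin n) {c : k}
    (hc : ρ (X i.castSucc.succ) = X i.castSucc.succ + C c) : c = 0 := by
  have h1 : tower l m g n (ρ (X i.succ.succ) - X i.succ.succ) =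
      Polynomial.aeval (X i.castSucc.succ) (Polynomial.taylor c (g i) - g i) := by
    rw [map_sub, ← hρ, tower_X_succ_succ, ← Polynomial.aeval_algHom_apply, hc, map_sub,
      Polynomial.taylor_apply, Polynomial.aeval_comp]
    simp
  set h := Polynomial.taylor c (g i) - g i with hh
  obtain ⟨c₀, b, hb⟩ := exists_eq_sum_of_tower_apply hm hlm hg
    (fun j => if j = i.castSucc then h else 0) (h1.trans (by
      rw [Finset.sum_eq_single i.castSucc] <;> simp +contextual))
  rw [hb] at h1
  have h2 : ∑ j : Fin n, C (b j) * Polynomial.aeval (X j.castSucc.succ) (g j) =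
      Polynomial.aeval (X i.castSucc.succ : MvPolynomial (Fin (n + 2)) k) h := by
    rw [← h1, map_add, map_sum, derivation_C, zero_add]
    refine Finset.sum_congr rfl fun j _ => ?_
    rw [Derivation.leibniz, derivation_C, smul_zero, add_zero, tower_X_succ_succ, smul_eq_mul]
  have h3 : ∀ j, b j = 0 := by
    intro j
    have h4 := congrArg (fun f : MvPolynomial (Fin (n + 2)) k => (aeval (Pi.single j.castSucc.succ
      Polynomial.X : Fin (n + 2) → Polynomial k) f).coeff (g j).natDegree) h2
    beta_reduce at h4
    rw [map_sum, Polynomial.finsetSum_coeff, Finset.sum_eq_single j] at h4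
    · rw [map_mul, aeval_C, aeval_single_aeval_self, Polynomial.algebraMap_apply,
        Algebra.algebraMap_self_apply, Polynomial.coeff_C_mul] at h4
      have h5 : (aeval (Pi.single j.castSucc.succ Polynomial.X : Fin (n + 2) → Polynomial k)
          (Polynomial.aeval (X i.castSucc.succ : MvPolynomial (Fin (n + 2)) k) h)).coeff
          (g j).natDegree = 0 := by
        by_cases hij : i = j
        · subst hij
          rw [aeval_single_aeval_self, hh, Polynomial.coeff_sub, Polynomial.coeff_taylor_natDegree,
            Polynomial.coeff_natDegree, sub_self]
        · exact coeff_aeval_single_aeval_of_ne (by simpa using hij) _ (hg j)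
      rw [h5, mul_eq_zero] at h4
      refine h4.resolve_right fun h0 => ?_
      have := hg j
      rw [Polynomial.leadingCoeff_eq_zero.mp h0] at this
      simp at this
    · intro j' _ hj'
      rw [map_mul, aeval_C, Polynomial.algebraMap_apply, Algebra.algebraMap_self_apply,
        Polynomial.coeff_C_mul, coeff_aeval_single_aeval_of_ne (by simpa using hj') _ (hg j),
        mul_zero]
    · simp
  simp only [h3, C_0, zero_mul, Finset.sum_const_zero] at h2
  have h4 : h = 0 := by
    by_contra h0
    exact transcendental_X k _ ⟨h, h0, h2.symm⟩
  exact Polynomial.eq_zero_of_taylor_eq_self (hg i) (sub_eq_zero.mp h4)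

theorem exists_eq_add_C_of_fixes [CharZero k] (hm : 0 < m) (hlm : ¬ m ∣ l)
    (hg : ∀ i, 0 < (g i).natDegree)
    {ρ : MvPolynomial (Fin (n + 2)) k →ₐ[k] MvPolynomial (Fin (n + 2)) k}
    (hρ : ∀ f, ρ (tower l m g n f) = tower l m g n (ρ f)) (i : Fin n)
    (hi : ρ (X i.castSucc.succ) = X i.castSucc.succ) :
    ∃ c, ρ (X i.succ.succ) = X i.succ.succ + C c := by
  obtain ⟨c, hc⟩ := onlyScalarPrimitives_tower hm hlm hg n
    (ρ (X i.succ.succ) - X i.succ.succ) 0 (by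
      rw [map_sub, ← hρ, tower_X_succ_succ, ← Polynomial.aeval_algHom_apply, hi, sub_self,
        map_zero])
  exact ⟨c, by rw [← algebraMap_eq, ← hc]; ring⟩

theorem fixes_of_commutes_tower [CharZero k] (hl : 0 < l) (hm : 0 < m) (hlm : ¬ m ∣ l)
    (hg : ∀ i, 0 < (g i).natDegree)
    {ρ : MvPolynomial (Fin (n + 2)) k →ₐ[k] MvPolynomial (Fin (n + 2)) k}
    (hρ : ∀ f, ρ (tower l m g n f) = tower l m g n (ρ f)) :
    ρ (X 0) = X 0 ∧ ∀ i : Fin n, ρ (X i.castSucc.succ) = X i.castSucc.succ := by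
  obtain ⟨h0, h1⟩ := orbit_tower_eq (g := g) (u := ρ (X 0)) (w := ρ (X 1)) hl hm hlm
    (by rw [← hρ, tower_X_zero]; simp) (by rw [← hρ, tower_X_one]; simp)
  refine ⟨h0, fun ⟨i, hi⟩ => ?_⟩
  induction i with
  | zero => exact h1
  | succ i ih =>
    obtain ⟨c, hc⟩ := exists_eq_add_C_of_fixes hm hlm hg hρ ⟨i, by omega⟩ (ih (by omega))
    have hc0 := eq_zero_of_translate hm hlm hg hρ ⟨i + 1, hi⟩ hc
    rw [hc0, C_0, add_zero] at hc
    exact hc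

theorem commutes_tower_iff [CharZero k] (hl : 0 < l) (hm : 0 < m) (hlm : ¬ m ∣ l)
    (hg : ∀ i, 0 < (g i).natDegree)
    (ρ : MvPolynomial (Fin (n + 3)) k ≃ₐ[k] MvPolynomial (Fin (n + 3)) k) :
    (∀ f, ρ (tower l m g (n + 1) f) = tower l m g (n + 1) (ρ f)) ↔
      ∃ c, (∀ j : Fin (n + 2), ρ (X j.castSucc) = X j.castSucc) ∧
        ρ (X (Fin.last (n + 2))) = X (Fin.last (n + 2)) + C c := by
  constructor
  · intro hρ
    obtain ⟨h0, h1⟩ := fixes_of_commutes_tower (ρ := ρ.toAlgHom) hl hm hlm hg hρ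
    obtain ⟨c, hc⟩ := exists_eq_add_C_of_fixes (ρ := ρ.toAlgHom) hm hlm hg hρ (Fin.last n)
      (h1 (Fin.last n))
    refine ⟨c, fun j => ?_, hc⟩
    induction j using Fin.cases with
    | zero => exact h0
    | succ j => exact h1 j
  · rintro ⟨c, h1, h2⟩
    have h3 : ∀ i : Fin (n + 3),
        tower l m g (n + 1) (ρ (X i)) = tower l m g (n + 1) (X i) := by
      intro i
      induction i using Fin.lastCases with
      | last => rw [h2, map_add, derivation_C, add_zero]
      | cast i => rw [h1]
    have h4 : ∀ i : Fin (n + 3), ρ (tower l m g (n + 1) (X i)) = tower l m g (n + 1) (X i) := by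
      intro i
      have h0 : ρ (X 0) = X 0 := h1 0
      induction i using Fin.cases with
      | zero =>
        have h5 : ρ (X 1) = X 1 := h1 1
        rw [tower_X_zero, map_add, map_mul, map_pow, map_one, h0, h5]
      | succ i =>
        induction i using Fin.cases with
        | zero =>
          rw [Fin.succ_zero_eq_one, tower_X_one, map_pow, h0]
        | succ i =>
          rw [tower_X_succ_succ, ← Polynomial.aeval_algHom_apply, Fin.succ_castSucc, h1]
    have h5 : (tower l m g (n + 1)).conj ρ = tower l m g (n + 1) := by
      apply derivation_ext
      intro i
      apply ρ.injective
      rw [Derivation.apply_conj, h3, h4]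
    intro f
    rw [← Derivation.apply_conj, h5]

end

end MvPolynomial

open MvPolynomial

/-- For `d₂ = (1 + x₁^{m2} x₂)∂_{x₁} + x₁^{m1}∂_{x₂}` with `m2 ∤ m1`, any
extension `d_n = d₂ + g₂(x₂)∂_{x₃} + … + g_{n-1}(x_{n-1})∂_{x_n}` with each `g_j`
nonconstant is simple, and its isotropy group is exactly the group of translations
`(x₁,…,x_{n-1}, x_n + c)`. (0-indexed variables: `X 0 = x₁`, etc.) -/
theorem stmt11 (k : Type*) [Field k] [CharZero k]
    (m1 m2 : ℕ) (hm1 : 0 < m1) (hm2 : 0 < m2) (hdvd : ¬ m2 ∣ m1)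
    (n : ℕ) (hn : 2 < n)
    (d2 : Derivation k (MvPolynomial (Fin 2) k) (MvPolynomial (Fin 2) k))
    (hd2x : d2 (X 0) = 1 + X 0 ^ m2 * X 1)
    (hd2y : d2 (X 1) = X 0 ^ m1)
    (G : ℕ → Polynomial k)
    (hGnc : ∀ j : ℕ, 2 ≤ j → j < n → 0 < (G j).natDegree)
    (dn : Derivation k (MvPolynomial (Fin n) k) (MvPolynomial (Fin n) k))
    (hres : ∀ j : Fin 2,
      dn (X (Fin.castLE hn.le j)) = rename (Fin.castLE hn.le) (d2 (X j)))
    (hG : ∀ (j : ℕ) (h1 : 2 ≤ j) (h2 : j < n),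
      dn (X (⟨j, h2⟩ : Fin n)) = Polynomial.aeval (X (⟨j - 1, by omega⟩ : Fin n)) (G j)) :
    (∀ I : Ideal (MvPolynomial (Fin n) k), (∀ f ∈ I, dn f ∈ I) → I = ⊥ ∨ I = ⊤) ∧
      (∀ ρ : MvPolynomial (Fin n) k ≃ₐ[k] MvPolynomial (Fin n) k,
        (∀ f, ρ (dn f) = dn (ρ f)) ↔
          ∃ c : k, (∀ j : Fin n, (j : ℕ) + 1 < n → ρ (X j) = X j) ∧
            ρ (X (⟨n - 1, by omega⟩ : Fin n)) = X (⟨n - 1, by omega⟩ : Fin n) + C c) := by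
  obtain ⟨N, rfl⟩ : ∃ N, n = N + 3 := ⟨n - 3, by omega⟩
  set g : ℕ → Polynomial k := fun i => if i + 2 < N + 3 then G (i + 2) else Polynomial.X with g_def
  have hg : ∀ i, 0 < (g i).natDegree := fun i => by
    rw [g_def]
    beta_reduce
    split_ifs with h
    · exact hGnc _ (by omega) h
    · rw [Polynomial.natDegree_X]
      exact one_pos
  obtain rfl : dn = tower m1 m2 g (N + 1) := by
    apply derivation_ext
    intro i
    induction i using Fin.cases with
    | zero =>
      have h := hres 0
      rw [hd2x, map_add, map_mul, map_pow, map_one, rename_X, rename_X] at h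
      rw [tower_X_zero]
      exact h
    | succ i =>
      induction i using Fin.cases with
      | zero =>
        have h := hres 1
        rw [hd2y, map_pow, rename_X] at h
        rw [Fin.succ_zero_eq_one, tower_X_one]
        exact h
      | succ i =>
        have h := hG (i + 2) (by omega) (by omega)
        rw [tower_X_succ_succ, g_def]
        beta_reduce
        rw [if_pos (by omega)]
        exact h
  refine ⟨isSimple_tower hm2 hdvd hg _, fun ρ => (commutes_tower_iff hm1 hm2 hdvd hg ρ).trans ?_⟩
  refine exists_congr fun c => and_congr ⟨fun h j hj => ?_, fun h j => ?_⟩ Iff.rfl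
  · exact h ⟨j, by omega⟩
  · exact h _ (by simp)
end
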